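/- arXiv:1412.8159 — 2 statements merged into one kernel-verified Lean document; each statement's English description precedes it below -/
import Mathlib

section
/- Let 0<s<1, let N be an integer with N>2s, let 0 < γ < (N-2s)/2 and let R > 0. Denote by B_R the open ball of radius R centered at the origin in ℝ^N. There exists a constant C = C(N,s,R,γ) > 0 such that for every measurable φ : B_R → ℝ with ‖φ‖_{Y^{s,γ}(B_R)} < ∞, C ( ∫_{B_R} |φ(x)|^{2*_s} |x|^{-2*_s γ} dx )^{2/2*_s} ≤ ∫_{B_R} ∫_{B_R} (φ(x)-φ(y))² dν + R^{-2s} ∫_{B_R} φ(x)² dμ, where 2*_s := 2N/(N-2s). -/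
open MeasureTheory Real Filter

noncomputable section

/-- Finiteness of the weighted Sobolev norm `‖φ‖_{Y^{s,γ}(O)} < ∞`, expressed as integrability
of both (nonnegative) integrands: `dμ = |x|^{-2γ} dx`, `dν = |x|^{-γ}|y|^{-γ}|x-y|^{-(N+2s)} dx dy`. -/
def YnormFinite (N : ℕ) (s γ : ℝ) (O : Set (EuclideanSpace ℝ (Fin N)))
    (φ : EuclideanSpace ℝ (Fin N) → ℝ) : Prop :=
  Integrable (fun x => φ x ^ 2 * ‖x‖ ^ (-(2 * γ))) (volume.restrict O) ∧
    Integrable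
      (fun p : EuclideanSpace ℝ (Fin N) × EuclideanSpace ℝ (Fin N) =>
        (φ p.1 - φ p.2) ^ 2 *
          (‖p.1‖ ^ (-γ) * ‖p.2‖ ^ (-γ) * ‖p.1 - p.2‖ ^ (-((N : ℝ) + 2 * s))))
      ((volume.restrict O).prod (volume.restrict O))

lemma lintegral_norm_rpow_compl_ball (N : ℕ) (hN : 0 < N) {a t : ℝ} (ha : 0 < a) (ht : 0 < t) :
    ∫⁻ x in {x : EuclideanSpace ℝ (Fin N) | t < ‖x‖}, ENNReal.ofReal (‖x‖ ^ (-(a + N))) =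
      ENNReal.ofReal (N * volume.real (Metric.ball (0 : EuclideanSpace ℝ (Fin N)) 1) / a *
        t ^ (-a)) := by
  have : Nonempty (Fin N) := ⟨⟨0, hN⟩⟩
  set f : ℝ → ℝ := (Set.Ioi t).indicator (fun ρ => ρ ^ (-(a + N))) with hf
  have hS : MeasurableSet {x : EuclideanSpace ℝ (Fin N) | t < ‖x‖} :=
    measurableSet_lt measurable_const measurable_norm
  have hpow : ∀ ρ ∈ Set.Ioi (0 : ℝ), ρ ^ (Module.finrank ℝ (EuclideanSpace ℝ (Fin N)) - 1) • f ρ =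
      (Set.Ioi t).indicator (fun ρ => ρ ^ (-a - 1)) ρ := by
    intro ρ hρ
    simp only [hf, Set.indicator, finrank_euclideanSpace, Fintype.card_fin, smul_eq_mul]
    split_ifs
    · rw [← Real.rpow_natCast, ← Real.rpow_add hρ]
      congr 1
      rw [Nat.cast_sub hN]; push_cast; ring
    · simp
  have hint : Integrable (fun x : EuclideanSpace ℝ (Fin N) => f ‖x‖) := by
    rw [integrable_fun_norm_addHaar, integrableOn_congr_fun hpow measurableSet_Ioi]
    exact ((integrable_indicator_iff measurableSet_Ioi).2
      (integrableOn_Ioi_rpow_of_lt (by linarith) ht)).integrableOn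
  have hnn : ∀ x : EuclideanSpace ℝ (Fin N), 0 ≤ f ‖x‖ := fun x =>
    Set.indicator_nonneg (fun ρ hρ => Real.rpow_nonneg (ht.le.trans (le_of_lt hρ)) _) _
  have hval : ∫ x : EuclideanSpace ℝ (Fin N), f ‖x‖ =
      N * volume.real (Metric.ball (0 : EuclideanSpace ℝ (Fin N)) 1) / a * t ^ (-a) := by
    rw [integral_fun_norm_addHaar, setIntegral_congr_fun measurableSet_Ioi hpow,
      integral_indicator measurableSet_Ioi, Measure.restrict_restrict measurableSet_Ioi,
      Set.inter_eq_left.2 (Set.Ioi_subset_Ioi ht.le), integral_Ioi_rpow_of_lt (by linarith) ht]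
    simp only [finrank_euclideanSpace, Fintype.card_fin, nsmul_eq_mul, smul_eq_mul]
    rw [show -a - 1 + 1 = -a by ring]
    field_simp
  rw [← hval, ofReal_integral_eq_lintegral_ofReal hint (ae_of_all _ hnn),
    ← lintegral_indicator hS]
  refine lintegral_congr fun x => ?_
  by_cases hx : t < ‖x‖ <;> simp [hf, hx]

lemma lintegral_ball_norm_rpow_ne_top (N : ℕ) (hN : 0 < N) {a : ℝ} (ha : a < N) (R : ℝ) :
    ∫⁻ x in Metric.ball (0 : EuclideanSpace ℝ (Fin N)) R, ENNReal.ofReal (‖x‖ ^ (-a)) ≠ ⊤ := by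
  have : Nonempty (Fin N) := ⟨⟨0, hN⟩⟩
  have hint : IntegrableOn (fun x : EuclideanSpace ℝ (Fin N) => ‖x‖ ^ (-a))
      (Metric.ball 0 R) := by
    rw [integrableOn_fun_norm_addHaar volume (f := fun ρ => ρ ^ (-a))]
    rcases le_or_gt R 0 with hR | hR
    · simp [Set.Ioo_eq_empty (not_lt.2 hR)]
    have h := (intervalIntegral.intervalIntegrable_rpow' (a := 0) (b := R)
      (show -1 < (N : ℝ) - 1 - a by linarith)).1
    refine (h.mono_set Set.Ioo_subset_Ioc_self).congr_fun (fun ρ hρ => ?_) measurableSet_Ioo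
    simp only [finrank_euclideanSpace, Fintype.card_fin, smul_eq_mul]
    rw [← Real.rpow_natCast, ← Real.rpow_add hρ.1, Nat.cast_sub hN]
    congr 1
    push_cast; ring
  exact hint.lintegral_lt_top.ne

/-- A ball centred on the line through `x`, between the spheres of radii `a‖x‖` and `b‖x‖`. -/
lemma ball_between {E : Type*} [NormedAddCommGroup E] [NormedSpace ℝ E] {x y : E} {a b : ℝ}
    (hab : 0 ≤ a + b)
    (hy : y ∈ Metric.ball (((a + b) / 2) • x) ((b - a) / 2 * ‖x‖)) :
    a * ‖x‖ < ‖y‖ ∧ ‖y‖ < b * ‖x‖ := by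
  rw [Metric.mem_ball, dist_eq_norm] at hy
  have h1 : ‖((a + b) / 2) • x‖ = (a + b) / 2 * ‖x‖ := by
    rw [norm_smul, Real.norm_of_nonneg (by linarith)]
  have h2 := norm_sub_norm_le y (((a + b) / 2) • x)
  have h3 := norm_sub_norm_le (((a + b) / 2) • x) y
  rw [norm_sub_rev] at h3
  constructor <;> nlinarith

lemma volume_ball_eq (N : ℕ) (x : EuclideanSpace ℝ (Fin N)) {r : ℝ} (hr : 0 < r) :
    volume (Metric.ball x r) =
      ENNReal.ofReal (volume.real (Metric.ball (0 : EuclideanSpace ℝ (Fin N)) 1) * r ^ N) := by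
  rw [Measure.addHaar_ball_of_pos _ _ hr, ENNReal.ofReal_mul (by positivity), mul_comm,
    ofReal_measureReal measure_ball_lt_top.ne]
  simp

lemma volume_real_unit_ball_pos (N : ℕ) :
    0 < volume.real (Metric.ball (0 : EuclideanSpace ℝ (Fin N)) 1) :=
  ENNReal.toReal_pos (Metric.measure_ball_pos _ _ one_pos).ne' measure_ball_lt_top.ne

/-- The integrand `(φ x - φ y)² |x|^{-γ} |y|^{-γ} |x - y|^{-q}` of the weighted Gagliardo energy. -/
def gagliardo {N : ℕ} (γ q : ℝ) (φ : EuclideanSpace ℝ (Fin N) → ℝ)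
    (x y : EuclideanSpace ℝ (Fin N)) : ℝ :=
  (φ x - φ y) ^ 2 * (‖x‖ ^ (-γ) * ‖y‖ ^ (-γ) * ‖x - y‖ ^ (-q))

lemma gagliardo_nonneg {N : ℕ} (γ q : ℝ) (φ : EuclideanSpace ℝ (Fin N) → ℝ)
    (x y : EuclideanSpace ℝ (Fin N)) : 0 ≤ gagliardo γ q φ x y := by
  unfold gagliardo; positivity

lemma measurable_gagliardo {N : ℕ} (γ q : ℝ) {φ : EuclideanSpace ℝ (Fin N) → ℝ}
    (hφ : Measurable φ) : Measurable (fun p : EuclideanSpace ℝ (Fin N) × EuclideanSpace ℝ (Fin N) =>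
      gagliardo γ q φ p.1 p.2) := by
  unfold gagliardo; fun_prop

lemma measurable_lintegral_gagliardo {N : ℕ} (γ q : ℝ) {φ : EuclideanSpace ℝ (Fin N) → ℝ}
    (hφ : Measurable φ) (ν : Measure (EuclideanSpace ℝ (Fin N))) [SFinite ν] :
    Measurable (fun x => ∫⁻ y, ENNReal.ofReal (gagliardo γ q φ x y) ∂ν) :=
  (measurable_gagliardo γ q hφ).ennreal_ofReal.lintegral_prod_right'

lemma ofReal_le_inv_mul_setLIntegral {α : Type*} [MeasurableSpace α] {μ : Measure α} {S : Set α}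
    {m c : ℝ} (hm : 0 < m) (hS : μ S = ENNReal.ofReal m) {F : α → ENNReal}
    (hF : ∀ᵐ y ∂μ.restrict S, ENNReal.ofReal c ≤ F y) :
    ENNReal.ofReal c ≤ ENNReal.ofReal m⁻¹ * ∫⁻ y in S, F y ∂μ := by
  have h := lintegral_mono_ae hF
  rw [setLIntegral_const, hS] at h
  calc ENNReal.ofReal c = ENNReal.ofReal m⁻¹ * (ENNReal.ofReal c * ENNReal.ofReal m) := by
        rw [mul_left_comm, ← ENNReal.ofReal_mul (by positivity), inv_mul_cancel₀ hm.ne']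
        simp
    _ ≤ _ := by gcongr

lemma sq_mul_rpow_le_gagliardo {N : ℕ} {s γ L : ℝ} (hs0 : 0 < s) (hγ0 : 0 < γ) (hL : 0 < L)
    (φ : EuclideanSpace ℝ (Fin N) → ℝ) {x y : EuclideanSpace ℝ (Fin N)} (hx : x ≠ 0)
    (h1 : ‖x‖ < ‖y‖) (h2 : ‖y‖ < (2 * L + 1) * ‖x‖) :
    φ x ^ 2 * ‖x‖ ^ (-(2 * γ + 2 * s)) ≤
      2 * ‖x‖ ^ (-(2 * γ + 2 * s)) * φ y ^ 2 +
        2 * (2 * L + 1) ^ γ * (2 * L + 2) ^ (N + 2 * s) * ‖x‖ ^ (N : ℝ) *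
          gagliardo γ (N + 2 * s) φ x y := by
  have hX : 0 < ‖x‖ := norm_pos_iff.2 hx
  have hY : 0 < ‖y‖ := hX.trans h1
  have hD : 0 < ‖x - y‖ := by
    refine norm_pos_iff.2 (sub_ne_zero.2 ?_)
    rintro rfl; exact lt_irrefl _ h1
  have hD2 : ‖x - y‖ ≤ (2 * L + 2) * ‖x‖ := (norm_sub_le x y).trans (by linarith)
  have e1 : ((2 * L + 1) * ‖x‖) ^ (-γ) ≤ ‖y‖ ^ (-γ) :=
    Real.rpow_le_rpow_of_nonpos hY h2.le (by linarith)
  have e2 : ((2 * L + 2) * ‖x‖) ^ (-(N + 2 * s)) ≤ ‖x - y‖ ^ (-(N + 2 * s)) :=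
    Real.rpow_le_rpow_of_nonpos hD hD2 (by linarith [(Nat.cast_nonneg N : (0 : ℝ) ≤ N)])
  have e3 : (2 * L + 1) ^ γ * (2 * L + 2) ^ (N + 2 * s) * ‖x‖ ^ (N : ℝ) * (‖x‖ ^ (-γ) *
      ((2 * L + 1) * ‖x‖) ^ (-γ) * ((2 * L + 2) * ‖x‖) ^ (-(N + 2 * s))) =
      ‖x‖ ^ (-(2 * γ + 2 * s)) := by
    rw [Real.mul_rpow (by positivity) hX.le, Real.mul_rpow (by positivity) hX.le]
    have a1 : (2 * L + 1) ^ γ * (2 * L + 1) ^ (-γ) = 1 := by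
      rw [← Real.rpow_add (by positivity)]; simp
    have a2 : (2 * L + 2) ^ (N + 2 * s) * (2 * L + 2) ^ (-(N + 2 * s)) = 1 := by
      rw [← Real.rpow_add (by positivity)]; simp
    have a3 : ‖x‖ ^ (N : ℝ) * ‖x‖ ^ (-γ) * ‖x‖ ^ (-γ) * ‖x‖ ^ (-(N + 2 * s)) =
        ‖x‖ ^ (-(2 * γ + 2 * s)) := by
      rw [← Real.rpow_add hX, ← Real.rpow_add hX, ← Real.rpow_add hX]; congr 1; ring
    calc _ = ((2 * L + 1) ^ γ * (2 * L + 1) ^ (-γ)) *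
          ((2 * L + 2) ^ (N + 2 * s) * (2 * L + 2) ^ (-(N + 2 * s))) *
          (‖x‖ ^ (N : ℝ) * ‖x‖ ^ (-γ) * ‖x‖ ^ (-γ) * ‖x‖ ^ (-(N + 2 * s))) := by ring
      _ = _ := by rw [a1, a2, a3]; ring
  have e4 : ‖x‖ ^ (-(2 * γ + 2 * s)) * (φ x - φ y) ^ 2 ≤
      (2 * L + 1) ^ γ * (2 * L + 2) ^ (N + 2 * s) * ‖x‖ ^ (N : ℝ) *
          gagliardo γ (N + 2 * s) φ x y := by
    rw [← e3, gagliardo]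
    calc _ ≤ (2 * L + 1) ^ γ * (2 * L + 2) ^ (N + 2 * s) * ‖x‖ ^ (N : ℝ) *
          (‖x‖ ^ (-γ) * ‖y‖ ^ (-γ) * ‖x - y‖ ^ (-(N + 2 * s))) * (φ x - φ y) ^ 2 := by gcongr
      _ = _ := by ring
  have e5 : φ x ^ 2 * ‖x‖ ^ (-(2 * γ + 2 * s)) ≤
      (2 * φ y ^ 2 + 2 * (φ x - φ y) ^ 2) * ‖x‖ ^ (-(2 * γ + 2 * s)) := by
    gcongr
    nlinarith [sq_nonneg (φ x - 2 * φ y)]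
  nlinarith

lemma ofReal_sq_mul_rpow_le {N : ℕ} {s γ L R : ℝ} (hs0 : 0 < s) (hγ0 : 0 < γ) (hL : 0 < L)
    {φ : EuclideanSpace ℝ (Fin N) → ℝ} (hφ : Measurable φ) {x : EuclideanSpace ℝ (Fin N)}
    (hx : x ≠ 0) (hxR : (2 * L + 1) * ‖x‖ ≤ R) :
    ENNReal.ofReal (φ x ^ 2 * ‖x‖ ^ (-(2 * γ + 2 * s))) ≤
      ENNReal.ofReal (2 / (volume.real (Metric.ball (0 : EuclideanSpace ℝ (Fin N)) 1) * L ^ N)) *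
        (ENNReal.ofReal (‖x‖ ^ (-(2 * γ + 2 * s + N))) *
        ∫⁻ y in Metric.ball (0 : EuclideanSpace ℝ (Fin N)) R,
          {y | ‖x‖ < ‖y‖ ∧ ‖y‖ < (2 * L + 1) * ‖x‖}.indicator
            (fun y => ENNReal.ofReal (φ y ^ 2)) y) +
      ENNReal.ofReal (2 * (2 * L + 1) ^ γ * (2 * L + 2) ^ (N + 2 * s) /
          (volume.real (Metric.ball (0 : EuclideanSpace ℝ (Fin N)) 1) * L ^ N)) *
        ∫⁻ y in Metric.ball (0 : EuclideanSpace ℝ (Fin N)) R,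
          ENNReal.ofReal (gagliardo γ (N + 2 * s) φ x y) := by
  have hX : 0 < ‖x‖ := norm_pos_iff.2 hx
  have hω := volume_real_unit_ball_pos N
  set ω := volume.real (Metric.ball (0 : EuclideanSpace ℝ (Fin N)) 1)
  set S := Metric.ball (((1 + (2 * L + 1)) / 2) • x) (((2 * L + 1) - 1) / 2 * ‖x‖)
  set A := {y : EuclideanSpace ℝ (Fin N) | ‖x‖ < ‖y‖ ∧ ‖y‖ < (2 * L + 1) * ‖x‖}
  have hSA : S ⊆ A := fun y hy => by
    have := ball_between (by linarith) hy
    exact ⟨by linarith [this.1], this.2⟩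
  have hSR : S ⊆ Metric.ball 0 R := fun y hy => by
    rw [mem_ball_zero_iff]; exact (hSA hy).2.trans_le hxR
  have hm : volume S = ENNReal.ofReal (ω * (L * ‖x‖) ^ N) := by
    rw [volume_ball_eq _ _ (by ring_nf; positivity)]; congr; ring
  have key := ofReal_le_inv_mul_setLIntegral (c := φ x ^ 2 * ‖x‖ ^ (-(2 * γ + 2 * s)))
    (F := fun y => ENNReal.ofReal (2 * ‖x‖ ^ (-(2 * γ + 2 * s))) *
          A.indicator (fun y => ENNReal.ofReal (φ y ^ 2)) y +
        ENNReal.ofReal (2 * (2 * L + 1) ^ γ * (2 * L + 2) ^ (N + 2 * s) * ‖x‖ ^ (N : ℝ)) *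
          ENNReal.ofReal (gagliardo γ (N + 2 * s) φ x y)) (by positivity) hm (by
      refine (ae_restrict_iff' measurableSet_ball).2 (ae_of_all _ fun y hy => ?_)
      rw [Set.indicator_of_mem (hSA hy), ← ENNReal.ofReal_mul (by positivity),
        ← ENNReal.ofReal_mul (by positivity), ← ENNReal.ofReal_add (by positivity)
        (mul_nonneg (by positivity) (gagliardo_nonneg ..))]
      exact ENNReal.ofReal_le_ofReal
        (sq_mul_rpow_le_gagliardo hs0 hγ0 hL φ hx (hSA hy).1 (hSA hy).2))
  have hA : MeasurableSet A := (measurableSet_lt measurable_const measurable_norm).inter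
    (measurableSet_lt measurable_norm measurable_const)
  have hg : Measurable fun y => ENNReal.ofReal (gagliardo γ (N + 2 * s) φ x y) :=
    ((measurable_gagliardo γ (N + 2 * s) hφ).comp measurable_prodMk_left).ennreal_ofReal
  refine key.trans ((mul_le_mul_right (lintegral_mono_set hSR) _).trans ?_)
  rw [lintegral_add_right _ (hg.const_mul _), lintegral_const_mul _ hg, lintegral_const_mul _
    ((hφ.pow_const 2).ennreal_ofReal.indicator hA), mul_add, ← mul_assoc, ← mul_assoc, ← mul_assoc,
    ← ENNReal.ofReal_mul (by positivity), ← ENNReal.ofReal_mul (by positivity),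
    ← ENNReal.ofReal_mul (by positivity)]
  refine le_of_eq ?_
  congr 3
  · rw [neg_add (2 * γ + 2 * s), Real.rpow_add hX, Real.rpow_neg hX.le N, Real.rpow_natCast, mul_pow]
    field_simp
  · rw [Real.rpow_natCast, mul_pow]
    field_simp

lemma ENNReal.le_two_mul_of_le_half_add {h k : ENNReal} (hh : h ≠ ⊤)
    (H : h ≤ ENNReal.ofReal (1 / 2) * h + k) : h ≤ 2 * k := by
  by_cases hk : k = ⊤
  · simp [hk]
  lift h to NNReal using hh
  lift k to NNReal using hk
  have e : ENNReal.ofReal (1 / 2) = ((1 / 2 : NNReal) : ENNReal) := by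
    rw [ENNReal.ofReal]; congr; ext; simp
  rw [e] at H
  norm_cast at H ⊢
  rw [← NNReal.coe_le_coe] at H ⊢
  push_cast at H ⊢
  linarith

lemma lintegral_average_le {N : ℕ} (hN : 0 < N) {a δ Λ : ℝ} (ha : 0 < a) (hδ : 0 < δ)
    (hΛ : 0 < Λ) (ν : Measure (EuclideanSpace ℝ (Fin N))) [SFinite ν] (hν : ν ≤ volume)
    {h : EuclideanSpace ℝ (Fin N) → ENNReal} (hh : Measurable h) :
    ∫⁻ x in {x | δ < ‖x‖}, ENNReal.ofReal (‖x‖ ^ (-(a + N))) *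
        ∫⁻ y, {y | ‖x‖ < ‖y‖ ∧ ‖y‖ < Λ * ‖x‖}.indicator h y ∂ν ∂ν ≤
      ENNReal.ofReal
        (N * volume.real (Metric.ball (0 : EuclideanSpace ℝ (Fin N)) 1) / a * Λ ^ a) *
        ∫⁻ y in {y | δ < ‖y‖}, h y * ENNReal.ofReal (‖y‖ ^ (-a)) ∂ν := by
  set D := {x : EuclideanSpace ℝ (Fin N) | δ < ‖x‖}
  have hD : MeasurableSet D := measurableSet_lt measurable_const measurable_norm
  set g : EuclideanSpace ℝ (Fin N) → ENNReal := fun x => ENNReal.ofReal (‖x‖ ^ (-(a + N)))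
  have hg : Measurable g := by fun_prop
  have hA : MeasurableSet {p : EuclideanSpace ℝ (Fin N) × EuclideanSpace ℝ (Fin N) |
      ‖p.1‖ < ‖p.2‖ ∧ ‖p.2‖ < Λ * ‖p.1‖} :=
    (measurableSet_lt measurable_fst.norm measurable_snd.norm).inter
      (measurableSet_lt measurable_snd.norm (measurable_fst.norm.const_mul Λ))
  have hA' : ∀ x, MeasurableSet {y : EuclideanSpace ℝ (Fin N) | ‖x‖ < ‖y‖ ∧ ‖y‖ < Λ * ‖x‖} :=
    fun x => measurable_prodMk_left hA
  have hjm : Measurable (fun p : EuclideanSpace ℝ (Fin N) × EuclideanSpace ℝ (Fin N) =>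
      g p.1 * {y | ‖p.1‖ < ‖y‖ ∧ ‖y‖ < Λ * ‖p.1‖}.indicator h p.2) := by
    refine (hg.comp measurable_fst).mul ?_
    exact (hh.comp measurable_snd).indicator hA
  calc _ = ∫⁻ x in D, ∫⁻ y, g x * {y | ‖x‖ < ‖y‖ ∧ ‖y‖ < Λ * ‖x‖}.indicator h y ∂ν ∂ν := by
        refine lintegral_congr fun x => ?_
        rw [lintegral_const_mul _ (hh.indicator (hA' x))]
    _ = ∫⁻ y, ∫⁻ x in D, g x * {y | ‖x‖ < ‖y‖ ∧ ‖y‖ < Λ * ‖x‖}.indicator h y ∂ν ∂ν :=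
        lintegral_lintegral_swap hjm.aemeasurable
    _ ≤ ∫⁻ y, D.indicator (fun y => ENNReal.ofReal
        (N * volume.real (Metric.ball (0 : EuclideanSpace ℝ (Fin N)) 1) / a * Λ ^ a) *
          (h y * ENNReal.ofReal (‖y‖ ^ (-a)))) y ∂ν := by
        refine lintegral_mono fun y => ?_
        by_cases hy : y ∈ D
        · have hY : 0 < ‖y‖ := hδ.trans hy
          have hT : MeasurableSet {x : EuclideanSpace ℝ (Fin N) | ‖y‖ / Λ < ‖x‖} :=
            measurableSet_lt measurable_const measurable_norm
          rw [Set.indicator_of_mem hy]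
          calc _ ≤ ∫⁻ x, h y * {x | ‖y‖ / Λ < ‖x‖}.indicator g x ∂volume := by
                refine (lintegral_mono' (Measure.restrict_le_self.trans hν) le_rfl).trans ?_
                refine lintegral_mono fun x => ?_
                by_cases hxy : ‖x‖ < ‖y‖ ∧ ‖y‖ < Λ * ‖x‖
                · have hx : x ∈ {x : EuclideanSpace ℝ (Fin N) | ‖y‖ / Λ < ‖x‖} := by
                    rw [Set.mem_ofPred_eq, div_lt_iff₀ hΛ, mul_comm]; exact hxy.2
                  simp only [Set.indicator_of_mem hx]
                  rw [mul_comm]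
                  gcongr
                  exact Set.indicator_le_self ..
                · rw [Set.indicator_of_notMem (by exact hxy)]; simp
            _ = _ := by
                rw [lintegral_const_mul _ (hg.indicator hT), lintegral_indicator hT,
                  lintegral_norm_rpow_compl_ball N hN ha (by positivity),
                  mul_left_comm, ← ENNReal.ofReal_mul (by positivity)]
                congr 2
                rw [Real.div_rpow hY.le hΛ.le, Real.rpow_neg hΛ.le a]
                field_simp
        · rw [Set.indicator_of_notMem hy]
          refine le_of_eq ?_
          refine (lintegral_congr_ae ((ae_restrict_iff' hD).2 (ae_of_all _ fun x hx => ?_))).trans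
            lintegral_zero
          rw [Set.indicator_of_notMem, mul_zero]
          rintro ⟨h1, -⟩
          exact hy (lt_trans hx h1)
    _ = _ := by
        rw [lintegral_indicator hD, lintegral_const_mul _ (by fun_prop)]

/-- The fractional Hardy inequality for the weighted energy on a ball. -/
lemma weighted_hardy_ball (N : ℕ) (s γ R : ℝ) (hs0 : 0 < s) (hγ0 : 0 < γ)
    (hγ : γ < ((N : ℝ) - 2 * s) / 2) (hR : 0 < R) :
    ∃ C : ℝ, ∀ φ : EuclideanSpace ℝ (Fin N) → ℝ, Measurable φ →
      ∫⁻ x in Metric.ball (0 : EuclideanSpace ℝ (Fin N)) R,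
        ENNReal.ofReal (φ x ^ 2 * ‖x‖ ^ (-(2 * γ))) ≠ ⊤ →
      ∫⁻ x in Metric.ball (0 : EuclideanSpace ℝ (Fin N)) R,
        ENNReal.ofReal (φ x ^ 2 * ‖x‖ ^ (-(2 * γ + 2 * s))) ≤
      ENNReal.ofReal C * ((∫⁻ x in Metric.ball (0 : EuclideanSpace ℝ (Fin N)) R,
        ∫⁻ y in Metric.ball (0 : EuclideanSpace ℝ (Fin N)) R,
          ENNReal.ofReal (gagliardo γ (N + 2 * s) φ x y)) +
        ∫⁻ x in Metric.ball (0 : EuclideanSpace ℝ (Fin N)) R,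
          ENNReal.ofReal (φ x ^ 2 * ‖x‖ ^ (-(2 * γ)))) := by
  have hN : 0 < N := by
    have : (0 : ℝ) < N := by linarith
    exact_mod_cast this
  have hω := volume_real_unit_ball_pos N
  set ω := volume.real (Metric.ball (0 : EuclideanSpace ℝ (Fin N)) 1)
  set a := 2 * γ + 2 * s with ha
  have ha0 : 0 < a := by positivity
  obtain ⟨L, hL1, hL⟩ : ∃ L : ℝ, 1 ≤ L ∧
      2 / (ω * L ^ N) * (N * ω / a * (2 * L + 1) ^ a) ≤ 1 / 2 := by
    have ht : Tendsto (fun L : ℝ => 2 * N / a * 3 ^ a * L ^ (-(N - a))) atTop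
        (nhds (2 * N / a * 3 ^ a * 0)) :=
      (tendsto_rpow_neg_atTop (by simp only [ha]; linarith)).const_mul _
    rw [mul_zero] at ht
    obtain ⟨L, hL, hL1⟩ := ((ht.eventually (ge_mem_nhds (by norm_num : (0 : ℝ) < 1 / 2))).and
      (eventually_ge_atTop 1)).exists
    refine ⟨L, hL1, le_trans ?_ hL⟩
    have hL0 : 0 < L := by linarith
    have e : (2 * L + 1) ^ a ≤ 3 ^ a * L ^ a := by
      rw [← Real.mul_rpow (by norm_num) hL0.le]
      exact Real.rpow_le_rpow (by positivity) (by linarith) ha0.le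
    rw [neg_sub, Real.rpow_sub hL0, Real.rpow_natCast]
    calc _ ≤ 2 / (ω * L ^ N) * (N * ω / a * (3 ^ a * L ^ a)) := by gcongr
      _ = _ := by field_simp
  have hL0 : 0 < L := by linarith
  set B := 2 * (2 * L + 1) ^ γ * (2 * L + 2) ^ (N + 2 * s) / (ω * L ^ N)
  set B' := (R / (2 * L + 1)) ^ (-(2 * s))
  have hB : 0 ≤ B := by positivity
  have hB' : 0 ≤ B' := by positivity
  refine ⟨2 * (B + B'), fun φ hφ hM => ?_⟩
  set ν := volume.restrict (Metric.ball (0 : EuclideanSpace ℝ (Fin N)) R)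
  set M := ∫⁻ x, ENNReal.ofReal (φ x ^ 2 * ‖x‖ ^ (-(2 * γ))) ∂ν
  set E := ∫⁻ x, ∫⁻ y, ENNReal.ofReal (gagliardo γ (N + 2 * s) φ x y) ∂ν ∂ν
  have hsplit : ∀ x : EuclideanSpace ℝ (Fin N), x ≠ 0 → φ x ^ 2 * ‖x‖ ^ (-a) =
      φ x ^ 2 * ‖x‖ ^ (-(2 * γ)) * ‖x‖ ^ (-(2 * s)) := fun x hx => by
    rw [mul_assoc, ← Real.rpow_add (norm_pos_iff.2 hx)]; congr 2; rw [ha]; ring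
  have htail : ∀ (x : EuclideanSpace ℝ (Fin N)) (r : ℝ), 0 < r → r ≤ ‖x‖ →
      ENNReal.ofReal (φ x ^ 2 * ‖x‖ ^ (-a)) ≤
        ENNReal.ofReal (r ^ (-(2 * s))) * ENNReal.ofReal (φ x ^ 2 * ‖x‖ ^ (-(2 * γ))) := by
    intro x r hr hrx
    rw [hsplit x (norm_pos_iff.1 (hr.trans_le hrx)), ← ENNReal.ofReal_mul (by positivity),
      mul_comm (r ^ _)]
    refine ENNReal.ofReal_le_ofReal ?_
    gcongr _ * ?_
    exact Real.rpow_le_rpow_of_nonpos hr hrx (by linarith)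
  have hmf : ∀ b : ℝ, Measurable fun x : EuclideanSpace ℝ (Fin N) =>
      ENNReal.ofReal (φ x ^ 2 * ‖x‖ ^ b) := fun b => by fun_prop
  have main : ∀ δ : ℝ, 0 < δ → ∫⁻ x in {x | δ < ‖x‖}, ENNReal.ofReal (φ x ^ 2 * ‖x‖ ^ (-a)) ∂ν ≤
      ENNReal.ofReal (2 * (B + B')) * (E + M) := by
    intro δ hδ
    have hD : MeasurableSet {x : EuclideanSpace ℝ (Fin N) | δ < ‖x‖} :=
      measurableSet_lt measurable_const measurable_norm
    have hrest : ∀ f : EuclideanSpace ℝ (Fin N) → ENNReal,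
        ∫⁻ x in {x | δ < ‖x‖}, f x ∂ν ≤ ∫⁻ x, f x ∂ν :=
      fun f => lintegral_mono' Measure.restrict_le_self le_rfl
    have hfin : ∫⁻ x in {x | δ < ‖x‖}, ENNReal.ofReal (φ x ^ 2 * ‖x‖ ^ (-a)) ∂ν ≠ ⊤ := by
      refine ne_top_of_le_ne_top (ENNReal.mul_ne_top ENNReal.ofReal_ne_top hM)
        (b := ENNReal.ofReal (δ ^ (-(2 * s))) * M) ?_
      rw [← lintegral_const_mul _ (hmf _)]
      refine le_trans ?_ (hrest _)
      exact setLIntegral_mono ((hmf _).const_mul _) fun x hx => htail x δ hδ (le_of_lt hx)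
    have hV := measurable_lintegral_gagliardo γ (N + 2 * s) hφ ν
    have hpt : ∫⁻ x in {x | δ < ‖x‖}, ENNReal.ofReal (φ x ^ 2 * ‖x‖ ^ (-a)) ∂ν ≤
        ∫⁻ x in {x | δ < ‖x‖}, (ENNReal.ofReal (2 / (ω * L ^ N)) *
          (ENNReal.ofReal (‖x‖ ^ (-(a + N))) *
            ∫⁻ y, {y | ‖x‖ < ‖y‖ ∧ ‖y‖ < (2 * L + 1) * ‖x‖}.indicator
              (fun y => ENNReal.ofReal (φ y ^ 2)) y ∂ν) +
          (ENNReal.ofReal B * ∫⁻ y, ENNReal.ofReal (gagliardo γ (N + 2 * s) φ x y) ∂ν +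
            ENNReal.ofReal B' * ENNReal.ofReal (φ x ^ 2 * ‖x‖ ^ (-(2 * γ))))) ∂ν := by
      refine lintegral_mono_ae ((ae_restrict_iff' hD).2 (ae_of_all _ fun x hx => ?_))
      have hx0 : x ≠ 0 := norm_pos_iff.1 (hδ.trans hx)
      rcases le_total ((2 * L + 1) * ‖x‖) R with hxR | hxR
      · refine (ofReal_sq_mul_rpow_le hs0 hγ0 hL0 hφ hx0 hxR).trans ?_
        gcongr
        exact le_self_add
      · refine (htail x (R / (2 * L + 1)) (by positivity)
          ((div_le_iff₀ (by positivity)).2 (by linarith))).trans ?_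
        exact le_add_left (le_add_left le_rfl)
    have habs := ENNReal.le_two_mul_of_le_half_add (k := ENNReal.ofReal (B + B') * (E + M)) hfin (by
      refine hpt.trans ?_
      rw [lintegral_add_right _ (by fun_prop), lintegral_add_right _ (by fun_prop),
        lintegral_const_mul' _ _ ENNReal.ofReal_ne_top,
        lintegral_const_mul' _ _ ENNReal.ofReal_ne_top,
        lintegral_const_mul' _ _ ENNReal.ofReal_ne_top]
      refine add_le_add ?_ ?_
      · refine (mul_le_mul_right (lintegral_average_le hN ha0 hδ (by positivity) ν
          Measure.restrict_le_self (by fun_prop)) _).trans ?_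
        rw [← mul_assoc, ← ENNReal.ofReal_mul (by positivity)]
        refine mul_le_mul' (ENNReal.ofReal_le_ofReal hL) (le_of_eq ?_)
        simp only [← ENNReal.ofReal_mul (sq_nonneg _)]
      · rw [mul_add]
        gcongr
        · linarith
        · exact hrest _
        · linarith
        · exact hrest _)
    refine habs.trans (le_of_eq ?_)
    rw [ENNReal.ofReal_mul (by norm_num), mul_assoc]; simp
  have hU : (⋃ n : ℕ, {x : EuclideanSpace ℝ (Fin N) | 1 / ((n : ℝ) + 1) < ‖x‖}) = {0}ᶜ := by
    ext x
    simp only [Set.mem_iUnion, Set.mem_ofPred_eq, Set.mem_compl_iff, Set.mem_singleton_iff]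
    refine ⟨fun ⟨n, hn⟩ => norm_pos_iff.1 (lt_trans (by positivity) hn),
      fun hx => exists_nat_one_div_lt (norm_pos_iff.2 hx)⟩
  have : Nonempty (Fin N) := ⟨⟨0, hN⟩⟩
  have hν0 : ν.restrict {0}ᶜ = ν := restrict_compl_singleton 0
  rw [← hν0, ← hU, setLIntegral_iUnion_of_directed]
  · exact iSup_le fun n => main _ (by positivity)
  · refine Monotone.directed_le fun m n hmn => ?_
    have h : 1 / ((n : ℝ) + 1) ≤ 1 / ((m : ℝ) + 1) := by gcongr
    exact fun x (hx : 1 / ((m : ℝ) + 1) < ‖x‖) => h.trans_lt hx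

lemma sq_le_gagliardo_add {N : ℕ} {q γ p r : ℝ} (hq : 0 < q) (hγ0 : 0 < γ) (hp : 2 < p)
    (φ : EuclideanSpace ℝ (Fin N) → ℝ) {x y : EuclideanSpace ℝ (Fin N)} (hy : y ≠ 0)
    (hxy : x ≠ y) (h1 : ‖y‖ ≤ ‖x‖) (h2 : ‖x - y‖ ≤ r) {t : ℝ} (ht : 0 < t)
    (htx : t = |φ x| * ‖x‖ ^ (-γ)) :
    t ^ 2 ≤ 2 * r ^ q * gagliardo γ q φ x y +
        2 * (t / 2) ^ (2 - p) * (|φ y| ^ p * ‖y‖ ^ (-(p * γ))) + t ^ 2 / 2 := by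
  have hY : 0 < ‖y‖ := norm_pos_iff.2 hy
  have hX : 0 < ‖x‖ := hY.trans_le h1
  have hD : 0 < ‖x - y‖ := norm_pos_iff.2 (sub_ne_zero.2 hxy)
  have hr : 0 < r := hD.trans_le h2
  have hw : ‖x‖ ^ (-γ) ≤ ‖y‖ ^ (-γ) := Real.rpow_le_rpow_of_nonpos hY h1 (by linarith)
  set z := |φ y| * ‖y‖ ^ (-γ) with hz
  have hz0 : 0 ≤ z := by positivity
  have e1 : |φ y| ^ p * ‖y‖ ^ (-(p * γ)) = z ^ p := by
    rw [hz, Real.mul_rpow (by positivity) (by positivity), ← Real.rpow_mul hY.le]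
    congr 2; ring
  have e2 : z ^ 2 ≤ (t / 2) ^ 2 + (t / 2) ^ (2 - p) * z ^ p := by
    rcases le_or_gt z (t / 2) with h | h
    · have : 0 ≤ (t / 2) ^ (2 - p) * z ^ p := by positivity
      nlinarith
    · have hzp : 0 < z := (by positivity : 0 < t / 2).trans h
      have : z ^ (2 - p) ≤ (t / 2) ^ (2 - p) :=
        Real.rpow_le_rpow_of_nonpos (by positivity) h.le (by linarith)
      calc z ^ 2 = z ^ (2 - p) * z ^ p := by
            rw [← Real.rpow_add hzp, sub_add_cancel]; norm_cast
        _ ≤ (t / 2) ^ (2 - p) * z ^ p := by gcongr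
        _ ≤ _ := le_add_of_nonneg_left (by positivity)
  have e3 : (|φ x - φ y| * ‖x‖ ^ (-γ)) ^ 2 ≤ r ^ q * gagliardo γ q φ x y := by
    have e : r ^ (-q) ≤ ‖x - y‖ ^ (-q) := Real.rpow_le_rpow_of_nonpos hD h2 (by linarith)
    have e' : r ^ q * r ^ (-q) = 1 := by rw [← Real.rpow_add hr]; simp
    rw [mul_pow, sq_abs, gagliardo]
    calc (φ x - φ y) ^ 2 * (‖x‖ ^ (-γ)) ^ 2
        = r ^ q * ((φ x - φ y) ^ 2 * (‖x‖ ^ (-γ) * ‖x‖ ^ (-γ) * r ^ (-q))) := by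
          linear_combination (-(φ x - φ y) ^ 2 * (‖x‖ ^ (-γ)) ^ 2) * e'
      _ ≤ _ := by gcongr
  have e4 : t ≤ |φ x - φ y| * ‖x‖ ^ (-γ) + z := by
    have h3 : |φ x| ≤ |φ x - φ y| + |φ y| := by
      simpa using abs_add_le (φ x - φ y) (φ y)
    calc t ≤ (|φ x - φ y| + |φ y|) * ‖x‖ ^ (-γ) := by rw [htx]; gcongr
      _ = |φ x - φ y| * ‖x‖ ^ (-γ) + |φ y| * ‖x‖ ^ (-γ) := by ring
      _ ≤ _ := by rw [hz]; gcongr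
  have e5 : t ^ 2 ≤ 2 * (|φ x - φ y| * ‖x‖ ^ (-γ)) ^ 2 + 2 * z ^ 2 := by
    have : t ^ 2 ≤ (|φ x - φ y| * ‖x‖ ^ (-γ) + z) ^ 2 := by gcongr
    nlinarith [sq_nonneg (|φ x - φ y| * ‖x‖ ^ (-γ) - z)]
  rw [e1]
  nlinarith

lemma sq_div_two_le_average {N : ℕ} (hN : 0 < N) {q γ p r R : ℝ} (hq : 0 < q) (hγ0 : 0 < γ)
    (hp : 2 < p)
    {φ : EuclideanSpace ℝ (Fin N) → ℝ} (hφ : Measurable φ) {x : EuclideanSpace ℝ (Fin N)}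
    (hxR : ‖x‖ ≤ R) (hr0 : 0 < r) (hr : r ≤ ‖x‖) {t : ℝ} (ht : 0 < t)
    (htx : t = |φ x| * ‖x‖ ^ (-γ))
    (hV : ∫⁻ y in Metric.ball (0 : EuclideanSpace ℝ (Fin N)) R,
      ENNReal.ofReal (gagliardo γ q φ x y) ≠ ⊤)
    (hU : ∫⁻ y in Metric.ball (0 : EuclideanSpace ℝ (Fin N)) R,
      ENNReal.ofReal (|φ y| ^ p * ‖y‖ ^ (-(p * γ))) ≠ ⊤) :
    t ^ 2 / 2 ≤ (volume.real (Metric.ball (0 : EuclideanSpace ℝ (Fin N)) 1) * (r / 2) ^ N)⁻¹ *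
      (2 * r ^ q * (∫⁻ y in Metric.ball (0 : EuclideanSpace ℝ (Fin N)) R,
        ENNReal.ofReal (gagliardo γ q φ x y)).toReal +
      2 * (t / 2) ^ (2 - p) * (∫⁻ y in Metric.ball (0 : EuclideanSpace ℝ (Fin N)) R,
        ENNReal.ofReal (|φ y| ^ p * ‖y‖ ^ (-(p * γ)))).toReal) := by
  have : Nonempty (Fin N) := ⟨⟨0, hN⟩⟩
  have hX : 0 < ‖x‖ := hr0.trans_le hr
  have hω := volume_real_unit_ball_pos N
  set ω := volume.real (Metric.ball (0 : EuclideanSpace ℝ (Fin N)) 1)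
  set V := ∫⁻ y in Metric.ball (0 : EuclideanSpace ℝ (Fin N)) R,
    ENNReal.ofReal (gagliardo γ q φ x y)
  set U := ∫⁻ y in Metric.ball (0 : EuclideanSpace ℝ (Fin N)) R,
    ENNReal.ofReal (|φ y| ^ p * ‖y‖ ^ (-(p * γ)))
  set κ := r / ‖x‖ with hκ
  have hκ0 : 0 < κ := by positivity
  have hκ1 : κ ≤ 1 := (div_le_one hX).2 hr
  have hκx : κ * ‖x‖ = r := by rw [hκ]; field_simp
  set S := Metric.ball ((((1 - κ) + 1) / 2) • x) ((1 - (1 - κ)) / 2 * ‖x‖) with hSdef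
  have hrad : (1 - (1 - κ)) / 2 * ‖x‖ = r / 2 := by rw [← hκx]; ring
  have hm : volume S = ENNReal.ofReal (ω * (r / 2) ^ N) := by
    rw [hSdef, hrad, volume_ball_eq _ _ (by positivity)]
  have hSx : ∀ y ∈ S, ‖y‖ < ‖x‖ := fun y hy => by
    simpa using (ball_between (by linarith) hy).2
  have hSR : S ⊆ Metric.ball 0 R := fun y hy => by
    rw [mem_ball_zero_iff]; exact (hSx y hy).trans_le hxR
  have hSr : ∀ y ∈ S, ‖x - y‖ ≤ r := fun y hy => by
    rw [hSdef, hrad, Metric.mem_ball, dist_eq_norm, norm_sub_rev] at hy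
    have h1 : ‖x - (((1 - κ) + 1) / 2) • x‖ = r / 2 := by
      rw [← hκx, show x - (((1 - κ) + 1) / 2) • x = (κ / 2) • x by module, norm_smul,
        Real.norm_of_nonneg (by positivity)]
      ring
    calc ‖x - y‖ ≤ ‖x - (((1 - κ) + 1) / 2) • x‖ + ‖(((1 - κ) + 1) / 2) • x - y‖ :=
          norm_sub_le_norm_sub_add_norm_sub ..
      _ ≤ r := by linarith
  have hg : Measurable fun y => ENNReal.ofReal (gagliardo γ q φ x y) :=
    ((measurable_gagliardo γ q hφ).comp measurable_prodMk_left).ennreal_ofReal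
  have hG : Measurable fun y : EuclideanSpace ℝ (Fin N) =>
      ENNReal.ofReal (|φ y| ^ p * ‖y‖ ^ (-(p * γ))) := by
    have : Measurable fun y => |φ y| := hφ.abs
    fun_prop
  set F : EuclideanSpace ℝ (Fin N) → ENNReal := fun y =>
    ENNReal.ofReal (2 * r ^ q) * ENNReal.ofReal (gagliardo γ q φ x y) +
      ENNReal.ofReal (2 * (t / 2) ^ (2 - p)) *
        ENNReal.ofReal (|φ y| ^ p * ‖y‖ ^ (-(p * γ))) with hF
  have hF2 : ∀ᵐ y ∂volume.restrict S, ENNReal.ofReal (t ^ 2 / 2) ≤ F y := by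
    refine (ae_restrict_iff' measurableSet_ball).2 ?_
    filter_upwards [Measure.ae_ne volume 0] with y hy0 hy
    have hxy : x ≠ y := by rintro rfl; exact lt_irrefl _ (hSx _ hy)
    have := sq_le_gagliardo_add hq hγ0 hp φ hy0 hxy (hSx y hy).le (hSr y hy) ht htx
    rw [hF]
    simp only
    rw [← ENNReal.ofReal_mul (by positivity), ← ENNReal.ofReal_mul (by positivity),
      ← ENNReal.ofReal_add (mul_nonneg (by positivity) (gagliardo_nonneg ..)) (by positivity)]
    exact ENNReal.ofReal_le_ofReal (by linarith)
  have key := (ofReal_le_inv_mul_setLIntegral (by positivity) hm hF2).trans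
    (mul_le_mul_right (lintegral_mono_set hSR) _)
  rw [hF, lintegral_add_right _ (hG.const_mul _), lintegral_const_mul _ hg,
    lintegral_const_mul _ hG] at key
  change _ ≤ _ * (_ * V + _ * U) at key
  rw [← ENNReal.ofReal_toReal hV, ← ENNReal.ofReal_toReal hU,
    ← ENNReal.ofReal_mul (by positivity), ← ENNReal.ofReal_mul (by positivity),
    ← ENNReal.ofReal_add (by positivity) (by positivity), ← ENNReal.ofReal_mul (by positivity)]
    at key
  exact (ENNReal.ofReal_le_ofReal_iff (by positivity)).1 key

lemma rpow_le_of_forall_average {N : ℕ} (hN : 0 < N) {s p k : ℝ} (hs0 : 0 < s)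
    (hp : p * (2 * s / N) = p - 2) (hk : 0 < k) {X t P v : ℝ} (hX : 0 < X) (ht : 0 < t)
    (hP : 0 < P) (hv : 0 ≤ v)
    (H : ∀ r, 0 < r → r ≤ X → t ^ 2 / 2 ≤
      (k * (r / 2) ^ N)⁻¹ * (2 * r ^ (N + 2 * s) * v + 2 * (t / 2) ^ (2 - p) * P)) :
    t ^ p ≤ (8 * (2 ^ N / k) + 1) * (8 * (2 ^ N / k) * 2 ^ (p - 2)) ^ (2 * s / N) *
      P ^ (2 * s / N) * (v + t ^ 2 * X ^ (-(2 * s))) := by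
  have hN' : (0 : ℝ) < N := by exact_mod_cast hN
  set Γ := 8 * (2 ^ N / k) * (2 : ℝ) ^ (p - 2) with hΓ
  have hΓ0 : 0 < Γ := by positivity
  set θ := 2 * s / N with hθ
  have hθ0 : 0 < θ := by positivity
  set r := (Γ * P / t ^ p) ^ (1 / (N : ℝ)) with hr
  have hr0 : 0 < r := by positivity
  have hrN : r ^ N = Γ * P / t ^ p := by
    rw [hr, ← Real.rpow_natCast, ← Real.rpow_mul (by positivity), one_div_mul_cancel hN'.ne',
      Real.rpow_one]
  have hrs : r ^ (2 * s) * t ^ (p - 2) = Γ ^ θ * P ^ θ := by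
    rw [hr, ← Real.rpow_mul (by positivity), show 1 / (N : ℝ) * (2 * s) = θ by rw [hθ]; ring,
      Real.div_rpow (by positivity) (by positivity), Real.mul_rpow hΓ0.le hP.le,
      ← Real.rpow_mul ht.le, hp]
    field_simp
  have htp : t ^ p = t ^ 2 * t ^ (p - 2) := by
    rw [← Real.rpow_natCast t 2, ← Real.rpow_add ht]; congr 1; push_cast; ring
  have hA : 0 ≤ Γ ^ θ * P ^ θ := by positivity
  have hB : 0 ≤ t ^ 2 * X ^ (-(2 * s)) := by positivity
  have hK : 0 < 8 * ((2 : ℝ) ^ N / k) := by positivity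
  rcases le_or_gt r X with h | h
  · have h1 := H r hr0 h
    have h2 : (k * (r / 2) ^ N)⁻¹ * (2 * r ^ (N + 2 * s) * v + 2 * (t / 2) ^ (2 - p) * P) =
        2 * (2 ^ N / k) * r ^ (2 * s) * v + t ^ 2 / 4 := by
      have e1 : (t / 2) ^ (2 - p) = 2 ^ (p - 2) * t ^ 2 / t ^ p := by
        rw [Real.div_rpow ht.le (by norm_num), Real.rpow_sub ht, ← neg_sub p 2,
          Real.rpow_neg (by norm_num)]
        norm_cast
        field_simp
      have e2 : r ^ ((N : ℝ) + 2 * s) = r ^ N * r ^ (2 * s) := by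
        rw [Real.rpow_add hr0, Real.rpow_natCast]
      rw [div_pow, e1, e2, mul_add]
      congr 1
      · field_simp
      · rw [hrN, hΓ]
        field_simp
        ring
    rw [h2] at h1
    have h3 : t ^ 2 ≤ 8 * (2 ^ N / k) * r ^ (2 * s) * v := by linarith
    calc t ^ p = t ^ 2 * t ^ (p - 2) := htp
      _ ≤ 8 * (2 ^ N / k) * r ^ (2 * s) * v * t ^ (p - 2) := by gcongr
      _ = 8 * (2 ^ N / k) * (Γ ^ θ * P ^ θ) * v := by rw [← hrs]; ring
      _ ≤ (8 * (2 ^ N / k) + 1) * (Γ ^ θ * P ^ θ) * (v + t ^ 2 * X ^ (-(2 * s))) := by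
        gcongr <;> linarith
      _ = _ := by ring
  · have h1 : X ^ (2 * s) ≤ r ^ (2 * s) := by gcongr
    have h2 : t ^ (p - 2) ≤ Γ ^ θ * P ^ θ * X ^ (-(2 * s)) := by
      rw [← hrs, Real.rpow_neg hX.le, ← div_eq_mul_inv, le_div_iff₀ (by positivity), mul_comm]
      gcongr
    calc t ^ p = t ^ 2 * t ^ (p - 2) := htp
      _ ≤ t ^ 2 * (Γ ^ θ * P ^ θ * X ^ (-(2 * s))) := by gcongr
      _ = 1 * (Γ ^ θ * P ^ θ) * (t ^ 2 * X ^ (-(2 * s))) := by ring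
      _ ≤ (8 * (2 ^ N / k) + 1) * (Γ ^ θ * P ^ θ) * (v + t ^ 2 * X ^ (-(2 * s))) := by
        gcongr <;> linarith
      _ = _ := by ring

/-- The weighted Sobolev inequality with a Hardy term, for functions whose critical norm is
already known to be finite. -/
lemma weighted_sobolev_hardy_ball (N : ℕ) (s γ R p : ℝ) (hN : 0 < N) (hs0 : 0 < s) (hγ0 : 0 < γ)
    (hp2 : 2 < p) (hp : p * (2 * s / N) = p - 2) :
    ∃ C : ℝ, 0 < C ∧ ∀ φ : EuclideanSpace ℝ (Fin N) → ℝ, Measurable φ →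
      ∫⁻ x in Metric.ball (0 : EuclideanSpace ℝ (Fin N)) R,
        ENNReal.ofReal (|φ x| ^ p * ‖x‖ ^ (-(p * γ))) ≠ ⊤ →
      (∫⁻ x in Metric.ball (0 : EuclideanSpace ℝ (Fin N)) R,
        ENNReal.ofReal (|φ x| ^ p * ‖x‖ ^ (-(p * γ)))) ^ (2 / p) ≤
      ENNReal.ofReal C * ((∫⁻ x in Metric.ball (0 : EuclideanSpace ℝ (Fin N)) R,
        ∫⁻ y in Metric.ball (0 : EuclideanSpace ℝ (Fin N)) R,
          ENNReal.ofReal (gagliardo γ (N + 2 * s) φ x y)) +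
        ∫⁻ x in Metric.ball (0 : EuclideanSpace ℝ (Fin N)) R,
          ENNReal.ofReal (φ x ^ 2 * ‖x‖ ^ (-(2 * γ + 2 * s)))) := by
  have hN' : (0 : ℝ) < N := by exact_mod_cast hN
  have : Nonempty (Fin N) := ⟨⟨0, hN⟩⟩
  have hω := volume_real_unit_ball_pos N
  set ω := volume.real (Metric.ball (0 : EuclideanSpace ℝ (Fin N)) 1)
  set C := (8 * (2 ^ N / ω) + 1) * (8 * (2 ^ N / ω) * 2 ^ (p - 2)) ^ (2 * s / N)
  have hC : 0 < C := by positivity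
  refine ⟨C, hC, fun φ hφ hU => ?_⟩
  set U := ∫⁻ x in Metric.ball (0 : EuclideanSpace ℝ (Fin N)) R,
    ENNReal.ofReal (|φ x| ^ p * ‖x‖ ^ (-(p * γ))) with hUdef
  by_cases hU0 : U = 0
  · rw [hU0, ENNReal.zero_rpow_of_pos (by positivity)]; exact zero_le
  have hP : 0 < U.toReal := ENNReal.toReal_pos hU0 hU
  set P := U.toReal with hPdef
  have hpt : ∀ᵐ x ∂volume.restrict (Metric.ball (0 : EuclideanSpace ℝ (Fin N)) R),
      ENNReal.ofReal (|φ x| ^ p * ‖x‖ ^ (-(p * γ))) ≤ ENNReal.ofReal (C * P ^ (2 * s / N)) *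
        ((∫⁻ y in Metric.ball (0 : EuclideanSpace ℝ (Fin N)) R,
          ENNReal.ofReal (gagliardo γ (N + 2 * s) φ x y)) +
          ENNReal.ofReal (φ x ^ 2 * ‖x‖ ^ (-(2 * γ + 2 * s)))) := by
    refine (ae_restrict_iff' measurableSet_ball).2 ?_
    filter_upwards [Measure.ae_ne volume 0] with x hx0 hx
    have hX : 0 < ‖x‖ := norm_pos_iff.2 hx0
    by_cases hφx : φ x = 0
    · simp [hφx, Real.zero_rpow (by linarith : p ≠ 0)]
    by_cases hV : ∫⁻ y in Metric.ball (0 : EuclideanSpace ℝ (Fin N)) R,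
          ENNReal.ofReal (gagliardo γ (N + 2 * s) φ x y) = ⊤
    · rw [hV, top_add, ENNReal.mul_top (ENNReal.ofReal_pos.2 (by positivity)).ne']
      exact le_top
    set t := |φ x| * ‖x‖ ^ (-γ) with ht
    have ht0 : 0 < t := by positivity
    have h := rpow_le_of_forall_average hN hs0 hp hω hX ht0 hP ENNReal.toReal_nonneg
      (fun r hr0 hr => sq_div_two_le_average hN (q := N + 2 * s) (by positivity) hγ0 hp2 hφ
        (mem_ball_zero_iff.1 hx).le hr0 hr ht0 ht hV hU)
    have e1 : |φ x| ^ p * ‖x‖ ^ (-(p * γ)) = t ^ p := by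
      rw [ht, Real.mul_rpow (by positivity) (by positivity), ← Real.rpow_mul hX.le]
      congr 2; ring
    have e2 : φ x ^ 2 * ‖x‖ ^ (-(2 * γ + 2 * s)) = t ^ 2 * ‖x‖ ^ (-(2 * s)) := by
      rw [ht, mul_pow, sq_abs, mul_assoc, ← Real.rpow_natCast (‖x‖ ^ (-γ)), ← Real.rpow_mul hX.le,
        ← Real.rpow_add hX]
      congr 2; push_cast; ring
    rw [e1, e2, ← ENNReal.ofReal_toReal hV, ← ENNReal.ofReal_add ENNReal.toReal_nonneg
      (by positivity), ← ENNReal.ofReal_mul (by positivity)]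
    exact ENNReal.ofReal_le_ofReal h
  have hint := lintegral_mono_ae hpt
  rw [lintegral_const_mul' _ _ ENNReal.ofReal_ne_top, lintegral_add_right _ (by fun_prop)] at hint
  set W := (∫⁻ x in Metric.ball (0 : EuclideanSpace ℝ (Fin N)) R,
        ∫⁻ y in Metric.ball (0 : EuclideanSpace ℝ (Fin N)) R,
          ENNReal.ofReal (gagliardo γ (N + 2 * s) φ x y)) +
        ∫⁻ x in Metric.ball (0 : EuclideanSpace ℝ (Fin N)) R,
          ENNReal.ofReal (φ x ^ 2 * ‖x‖ ^ (-(2 * γ + 2 * s)))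
  by_cases hW : W = ⊤
  · rw [hW, ENNReal.mul_top (ENNReal.ofReal_pos.2 hC).ne']; exact le_top
  rw [← hUdef, ← ENNReal.ofReal_toReal hU, ← ENNReal.ofReal_toReal hW,
    ← ENNReal.ofReal_mul (by positivity), ENNReal.ofReal_le_ofReal_iff (by positivity)] at hint
  rw [← ENNReal.ofReal_toReal hU, ← ENNReal.ofReal_toReal hW,
    ENNReal.ofReal_rpow_of_pos hP, ← ENNReal.ofReal_mul hC.le]
  refine ENNReal.ofReal_le_ofReal ?_
  have e : P ^ (2 / p) * P ^ (2 * s / N) = P := by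
    rw [← Real.rpow_add hP, show 2 / p + 2 * s / N = 1 by
      have : p ≠ 0 := by linarith
      rw [eq_comm, ← mul_right_inj' this, mul_add, hp]; field_simp; ring, Real.rpow_one]
  have hPp : 0 < P ^ (2 * s / N) := by positivity
  refine le_of_mul_le_mul_right ?_ hPp
  rw [e]
  linarith

lemma abs_clamp_sub_clamp_le (a b n : ℝ) :
    |max (min a n) (-n) - max (min b n) (-n)| ≤ |a - b| := by
  refine (abs_max_sub_max_le_abs _ _ _).trans ?_
  simpa using abs_min_sub_min_le_max a n b n

lemma abs_clamp_le (a : ℝ) {n : ℝ} (hn : 0 ≤ n) : |max (min a n) (-n)| ≤ n :=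
  abs_le.2 ⟨le_max_right _ _, max_le (min_le_right _ _) (by linarith)⟩

lemma clamp_eq_self {a n : ℝ} (h : |a| ≤ n) : max (min a n) (-n) = a := by
  rw [min_eq_left (abs_le.1 h).2, max_eq_left (abs_le.1 h).1]

lemma sq_clamp_le_sq (a : ℝ) {n : ℝ} (hn : 0 ≤ n) : max (min a n) (-n) ^ 2 ≤ a ^ 2 := by
  have h := abs_clamp_sub_clamp_le a 0 n
  rw [clamp_eq_self (a := 0) (by simpa using hn), sub_zero, sub_zero] at h
  exact sq_le_sq.2 h

lemma weighted_sobolev_ball_lintegral (N : ℕ) (s γ R p : ℝ) (hN : 0 < N) (hs0 : 0 < s)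
    (hγ0 : 0 < γ) (hγ : γ < ((N : ℝ) - 2 * s) / 2) (hR : 0 < R)
    (hp2 : 2 < p) (hp : p * (2 * s / N) = p - 2) (hpγ : p * γ < N) :
    ∃ C : ℝ, ∀ φ : EuclideanSpace ℝ (Fin N) → ℝ, Measurable φ →
      ∫⁻ x in Metric.ball (0 : EuclideanSpace ℝ (Fin N)) R,
        ENNReal.ofReal (φ x ^ 2 * ‖x‖ ^ (-(2 * γ))) ≠ ⊤ →
      (∫⁻ x in Metric.ball (0 : EuclideanSpace ℝ (Fin N)) R,
        ENNReal.ofReal (|φ x| ^ p * ‖x‖ ^ (-(p * γ)))) ^ (2 / p) ≤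
      ENNReal.ofReal C * ((∫⁻ x in Metric.ball (0 : EuclideanSpace ℝ (Fin N)) R,
        ∫⁻ y in Metric.ball (0 : EuclideanSpace ℝ (Fin N)) R,
          ENNReal.ofReal (gagliardo γ (N + 2 * s) φ x y)) +
        ∫⁻ x in Metric.ball (0 : EuclideanSpace ℝ (Fin N)) R,
          ENNReal.ofReal (φ x ^ 2 * ‖x‖ ^ (-(2 * γ)))) := by
  obtain ⟨C₁, hC₁, h₁⟩ := weighted_sobolev_hardy_ball N s γ R p hN hs0 hγ0 hp2 hp
  obtain ⟨C₂, h₂⟩ := weighted_hardy_ball N s γ R hs0 hγ0 hγ hR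
  have hp0 : 0 < 2 / p := by positivity
  refine ⟨C₁ * (1 + |C₂|), fun φ hφ hM => ?_⟩
  set ν := volume.restrict (Metric.ball (0 : EuclideanSpace ℝ (Fin N)) R)
  have hH := h₂ φ hφ hM
  set M := ∫⁻ x, ENNReal.ofReal (φ x ^ 2 * ‖x‖ ^ (-(2 * γ))) ∂ν
  set E := ∫⁻ x, ∫⁻ y, ENNReal.ofReal (gagliardo γ (N + 2 * s) φ x y) ∂ν ∂ν
  set H := ∫⁻ x, ENNReal.ofReal (φ x ^ 2 * ‖x‖ ^ (-(2 * γ + 2 * s))) ∂ν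
  set K := ENNReal.ofReal (C₁ * (1 + |C₂|)) * (E + M) with hK
  have hEH : ENNReal.ofReal C₁ * (E + H) ≤ K := by
    rw [hK, ENNReal.ofReal_mul hC₁.le, mul_assoc, ENNReal.ofReal_add zero_le_one (abs_nonneg _),
      add_mul, ENNReal.ofReal_one, one_mul]
    gcongr
    · exact le_self_add
    · refine hH.trans ?_
      gcongr
      exact le_abs_self _
  set Φ : ℕ → EuclideanSpace ℝ (Fin N) → ℝ := fun n x => max (min (φ x) n) (-n) with hΦ
  have hΦm : ∀ n, Measurable (Φ n) := fun n => (hφ.min measurable_const).max measurable_const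
  have hGm : ∀ n, Measurable fun x => ENNReal.ofReal (|Φ n x| ^ p * ‖x‖ ^ (-(p * γ))) := by
    intro n
    have : Measurable fun x => |Φ n x| := (hΦm n).abs
    fun_prop
  have hbound : ∀ n, ∫⁻ x, ENNReal.ofReal (|Φ n x| ^ p * ‖x‖ ^ (-(p * γ))) ∂ν ≤ K ^ (2 / p)⁻¹ := by
    intro n
    have hfin : ∫⁻ x, ENNReal.ofReal (|Φ n x| ^ p * ‖x‖ ^ (-(p * γ))) ∂ν ≠ ⊤ := by
      refine ne_top_of_le_ne_top (b := ENNReal.ofReal ((n : ℝ) ^ p) *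
        ∫⁻ x, ENNReal.ofReal (‖x‖ ^ (-(p * γ))) ∂ν) (ENNReal.mul_ne_top ENNReal.ofReal_ne_top
          (lintegral_ball_norm_rpow_ne_top N hN hpγ R)) ?_
      rw [← lintegral_const_mul' _ _ ENNReal.ofReal_ne_top]
      refine lintegral_mono fun x => ?_
      rw [← ENNReal.ofReal_mul (by positivity)]
      refine ENNReal.ofReal_le_ofReal ?_
      gcongr
      exact abs_clamp_le _ n.cast_nonneg
    rw [← ENNReal.rpow_le_rpow_iff hp0, ENNReal.rpow_inv_rpow hp0.ne']
    refine ((h₁ (Φ n) (hΦm n) hfin).trans ?_).trans hEH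
    refine mul_le_mul_right (add_le_add (lintegral_mono fun x => lintegral_mono fun y =>
      ENNReal.ofReal_le_ofReal (mul_le_mul_of_nonneg_right ?_ (by positivity)))
      (lintegral_mono fun x => ENNReal.ofReal_le_ofReal
        (mul_le_mul_of_nonneg_right ?_ (by positivity)))) _
    · exact sq_le_sq.2 (abs_clamp_sub_clamp_le _ _ _)
    · exact sq_clamp_le_sq _ n.cast_nonneg
  have hlim : ∀ x, ENNReal.ofReal (|φ x| ^ p * ‖x‖ ^ (-(p * γ))) =
      liminf (fun n => ENNReal.ofReal (|Φ n x| ^ p * ‖x‖ ^ (-(p * γ)))) atTop := by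
    intro x
    refine (Tendsto.liminf_eq (tendsto_const_nhds.congr' ?_)).symm
    filter_upwards [eventually_ge_atTop ⌈|φ x|⌉₊] with n hn
    simp only [hΦ]
    rw [clamp_eq_self (Nat.ceil_le.1 hn)]
  have hU : ∫⁻ x, ENNReal.ofReal (|φ x| ^ p * ‖x‖ ^ (-(p * γ))) ∂ν ≤ K ^ (2 / p)⁻¹ := by
    rw [lintegral_congr hlim]
    refine (lintegral_liminf_le hGm).trans ?_
    refine (liminf_le_liminf (Eventually.of_forall hbound)).trans ?_
    simp
  calc _ ≤ (K ^ (2 / p)⁻¹) ^ (2 / p) := by gcongr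
    _ = K := ENNReal.rpow_inv_rpow hp0.ne' K

/-- **Improved weighted Sobolev inequality on a ball**: for `0 < s < 1`, `N > 2s`,
`0 < γ < (N-2s)/2` and `R > 0`, there exists `C = C(N,s,R,γ) > 0` such that for every
`φ ∈ Y^{s,γ}(B_R)`,
`C (∫_{B_R} |φ|^{2*_s} |x|^{-2*_s γ} dx)^{2/2*_s}
  ≤ ∫_{B_R}∫_{B_R} (φ(x)-φ(y))² dν + R^{-2s} ∫_{B_R} φ² dμ`, where `2*_s = 2N/(N-2s)`. -/
theorem weighted_sobolev_ball (N : ℕ) (s γ R : ℝ) (hs0 : 0 < s) (hs1 : s < 1)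
    (hN : 2 * s < (N : ℝ)) (hγ0 : 0 < γ) (hγ : γ < ((N : ℝ) - 2 * s) / 2) (hR : 0 < R) :
    ∃ C : ℝ, 0 < C ∧ ∀ φ : EuclideanSpace ℝ (Fin N) → ℝ, Measurable φ →
      YnormFinite N s γ (Metric.ball (0 : EuclideanSpace ℝ (Fin N)) R) φ →
      C * (∫ x in Metric.ball (0 : EuclideanSpace ℝ (Fin N)) R,
            |φ x| ^ (2 * (N : ℝ) / ((N : ℝ) - 2 * s)) *
              ‖x‖ ^ (-(2 * (N : ℝ) / ((N : ℝ) - 2 * s) * γ))) ^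
          (2 / (2 * (N : ℝ) / ((N : ℝ) - 2 * s))) ≤
        (∫ x in Metric.ball (0 : EuclideanSpace ℝ (Fin N)) R,
          ∫ y in Metric.ball (0 : EuclideanSpace ℝ (Fin N)) R,
            (φ x - φ y) ^ 2 * (‖x‖ ^ (-γ) * ‖y‖ ^ (-γ) * ‖x - y‖ ^ (-((N : ℝ) + 2 * s)))) +
          R ^ (-(2 * s)) *
            ∫ x in Metric.ball (0 : EuclideanSpace ℝ (Fin N)) R,
              φ x ^ 2 * ‖x‖ ^ (-(2 * γ)) := by
  set p := 2 * (N : ℝ) / ((N : ℝ) - 2 * s) with hpdef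
  have hN0 : (0 : ℝ) < N := by linarith
  have hd : 0 < (N : ℝ) - 2 * s := by linarith
  have hp2 : 2 < p := by rw [hpdef, lt_div_iff₀ hd]; linarith
  have hp : p * (2 * s / N) = p - 2 := by rw [hpdef]; field_simp; ring
  have hpγ : p * γ < N := by
    rw [hpdef, div_mul_eq_mul_div, div_lt_iff₀ hd]
    nlinarith
  obtain ⟨C, h⟩ := weighted_sobolev_ball_lintegral N s γ R p (by exact_mod_cast hN0) hs0 hγ0 hγ hR
    hp2 hp hpγ
  set A := max 1 (R ^ (2 * s)) with hA
  have hA1 : 1 ≤ A := le_max_left _ _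
  set D := (|C| + 1) * A with hD
  have hD0 : 0 < D := by positivity
  refine ⟨D⁻¹, by positivity, fun φ hφ hY => ?_⟩
  have hYM := ofReal_integral_eq_lintegral_ofReal hY.1 (ae_of_all _ fun x => by positivity)
  have hYE := ofReal_integral_eq_lintegral_ofReal hY.2 (ae_of_all _ fun x => by positivity)
  rw [integral_prod _ hY.2, lintegral_prod _
    (by simpa only [gagliardo] using
      (measurable_gagliardo γ (N + 2 * s) hφ).ennreal_ofReal.aemeasurable)] at hYE
  have key := h φ hφ (by rw [← hYM]; exact ENNReal.ofReal_ne_top)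
  simp only [gagliardo] at key
  rw [← hYM, ← hYE] at key
  rw [integral_eq_lintegral_of_nonneg_ae (ae_of_all _ fun x => by positivity)
    (by have : Measurable fun x => |φ x| := hφ.abs
        exact Measurable.aestronglyMeasurable (by fun_prop)), ENNReal.toReal_rpow]
  set M := ∫ x in Metric.ball (0 : EuclideanSpace ℝ (Fin N)) R, φ x ^ 2 * ‖x‖ ^ (-(2 * γ))
  set E := ∫ x in Metric.ball (0 : EuclideanSpace ℝ (Fin N)) R,
    ∫ y in Metric.ball (0 : EuclideanSpace ℝ (Fin N)) R,
      (φ x - φ y) ^ 2 * (‖x‖ ^ (-γ) * ‖y‖ ^ (-γ) * ‖x - y‖ ^ (-((N : ℝ) + 2 * s)))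
  have hM0 : 0 ≤ M := integral_nonneg fun x => by positivity
  have hE0 : 0 ≤ E := integral_nonneg fun x => integral_nonneg fun y => by positivity
  rw [← ENNReal.ofReal_add hE0 hM0] at key
  have key2 := ENNReal.toReal_mono (ENNReal.mul_ne_top ENNReal.ofReal_ne_top ENNReal.ofReal_ne_top)
    key
  rw [ENNReal.toReal_mul, ENNReal.toReal_ofReal (add_nonneg hE0 hM0)] at key2
  have hC : (ENNReal.ofReal C).toReal ≤ |C| + 1 := by
    rw [ENNReal.toReal_ofReal']
    exact max_le (by linarith [le_abs_self C]) (by positivity)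
  have hMA : M ≤ A * (R ^ (-(2 * s)) * M) := by
    have e : R ^ (2 * s) * R ^ (-(2 * s)) = 1 := by rw [← Real.rpow_add hR]; simp
    calc M = R ^ (2 * s) * (R ^ (-(2 * s)) * M) := by rw [← mul_assoc, e, one_mul]
      _ ≤ _ := by gcongr; exact le_max_right _ _
  rw [inv_mul_le_iff₀ hD0]
  refine key2.trans ?_
  calc _ ≤ (|C| + 1) * (E + M) := by gcongr
    _ ≤ (|C| + 1) * (A * E + A * (R ^ (-(2 * s)) * M)) := by
      gcongr
      exact le_mul_of_one_le_left hE0 hA1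
    _ = _ := by rw [hD]; ring

end
end

section
/- Let 0<s<1, let N be an integer with N>2s, and let 0 < γ < (N-2s)/2. Let B_1 ⊂ ℝ^N be the open unit ball, let w : B_1 → ℝ be measurable with ‖w‖_{Y^{s,γ}(B_1)} < ∞, and let ψ : ℝ^N → ℝ be a radial function, ψ(x) = h(|x|) with h nonincreasing, supported in B_1, with 0 ≤ ψ ≤ 1 and ψ not identically zero. Set W_ψ := ( ∫_{B_1} w(x) ψ(x) dμ ) / ( ∫_{B_1} ψ(x) dμ ). Then there exists C = C(N,s,γ,ψ) > 0 such that ∫_{B_1} (w(x) − W_ψ)² ψ(x) dμ ≤ C ∫_{B_1} ∫_{B_1} (w(x)−w(y))² min{ψ(x),ψ(y)} dν. -/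
open MeasureTheory Real Filter

noncomputable section

/-- A one-step comparison between two weighted variances with a common centre `c`. -/
lemma lintegral_sq_sub_le_of_pair_bound {X : Type*} [MeasurableSpace X] {μ : Measure X}
    {A B : Set X} (hA : MeasurableSet A) (hB : MeasurableSet B)
    {a b : X → ENNReal} (ha : Measurable a) (hb : Measurable b)
    {w : X → ℝ} (hw : Measurable w) (c : ℝ) {F : X → X → ENNReal} {K : ENNReal} (hK : K ≠ ⊤)
    (h : ∀ x ∈ A, ∀ y ∈ B, a x * b y * ENNReal.ofReal ((w x - w y) ^ 2) ≤ K * F x y) :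
    (∫⁻ y in B, b y ∂μ) * ∫⁻ x in A, a x * ENNReal.ofReal ((w x - c) ^ 2) ∂μ ≤
      2 * ((∫⁻ x in A, a x ∂μ) * ∫⁻ y in B, b y * ENNReal.ofReal ((w y - c) ^ 2) ∂μ) +
        2 * K * ∫⁻ x in A, ∫⁻ y in B, F x y ∂μ ∂μ := by
  have h2K : 2 * K ≠ ⊤ := ENNReal.mul_ne_top (by simp) hK
  have hsq (x y : X) : ENNReal.ofReal ((w x - c) ^ 2) ≤
      2 * ENNReal.ofReal ((w y - c) ^ 2) + 2 * ENNReal.ofReal ((w x - w y) ^ 2) := by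
    rw [← ENNReal.ofReal_ofNat 2, ← ENNReal.ofReal_mul (by norm_num),
      ← ENNReal.ofReal_mul (by norm_num), ← ENNReal.ofReal_add (by positivity) (by positivity)]
    exact ENNReal.ofReal_le_ofReal (by nlinarith [sq_nonneg ((w y - c) - (w x - w y))])
  have hpt : ∀ x ∈ A, ∀ y ∈ B, b y * (a x * ENNReal.ofReal ((w x - c) ^ 2)) ≤
      (2 * a x) * (b y * ENNReal.ofReal ((w y - c) ^ 2)) + 2 * K * F x y := by
    intro x hx y hy
    calc b y * (a x * ENNReal.ofReal ((w x - c) ^ 2))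
        ≤ b y * (a x * (2 * ENNReal.ofReal ((w y - c) ^ 2) +
            2 * ENNReal.ofReal ((w x - w y) ^ 2))) := by gcongr; exact hsq x y
      _ = (2 * a x) * (b y * ENNReal.ofReal ((w y - c) ^ 2)) +
            2 * (a x * b y * ENNReal.ofReal ((w x - w y) ^ 2)) := by ring
      _ ≤ _ := by
        rw [mul_assoc 2 K]
        exact add_le_add le_rfl (mul_le_mul_right (h x hx y hy) 2)
  rw [← lintegral_const_mul _ (by fun_prop)]
  calc ∫⁻ x in A, (∫⁻ y in B, b y ∂μ) * (a x * ENNReal.ofReal ((w x - c) ^ 2)) ∂μ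
      ≤ ∫⁻ x in A, ((2 * a x) * (∫⁻ y in B, b y * ENNReal.ofReal ((w y - c) ^ 2) ∂μ) +
          2 * K * ∫⁻ y in B, F x y ∂μ) ∂μ := by
        refine setLIntegral_mono' hA fun x hx => ?_
        rw [← lintegral_mul_const _ hb, ← lintegral_const_mul _ (by fun_prop),
          ← lintegral_const_mul' _ _ h2K, ← lintegral_add_left (by fun_prop)]
        exact setLIntegral_mono' hB fun y hy => hpt x hx y hy
    _ = _ := by
        rw [lintegral_add_left (by fun_prop), lintegral_const_mul' _ _ h2K,
          lintegral_mul_const _ (by fun_prop), lintegral_const_mul _ ha, mul_assoc 2]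

lemma lintegral_lintegral_sq_sub_le {X : Type*} [MeasurableSpace X] {μ : Measure X}
    {A B : Set X} (hA : MeasurableSet A) (hB : MeasurableSet B)
    {a b : X → ENNReal} (ha : Measurable a)
    {w : X → ℝ} (hw : Measurable w) {F : X → X → ENNReal} {K : ENNReal} (hK : K ≠ ⊤)
    (h : ∀ x ∈ A, ∀ y ∈ B, a y * b x * ENNReal.ofReal ((w x - w y) ^ 2) ≤ K * F x y) :
    ∫⁻ x in A, b x * ∫⁻ y in B, a y * ENNReal.ofReal ((w y - w x) ^ 2) ∂μ ∂μ ≤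
      K * ∫⁻ x in A, ∫⁻ y in B, F x y ∂μ ∂μ := by
  rw [← lintegral_const_mul' _ _ hK]
  refine setLIntegral_mono' hA fun x hx => ?_
  rw [← lintegral_const_mul' _ _ hK, ← lintegral_const_mul _ (by fun_prop)]
  refine setLIntegral_mono' hB fun y hy => ?_
  rw [show (w y - w x) ^ 2 = (w x - w y) ^ 2 by ring, ← mul_assoc, mul_comm (b x)]
  exact h x hx y hy

lemma ENNReal.tsum_le_of_succ_le_half_add {S e : ℕ → ENNReal}
    (h : ∀ k, S (k + 1) ≤ S k / 2 + e k) : ∑' k, S k ≤ 2 * (S 0 + ∑' k, e k) := by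
  have key (n : ℕ) : ∑ k ∈ Finset.range n, S k ≤ 2 * (S 0 + ∑' k, e k) := by
    induction n with
    | zero => simp
    | succ n ih =>
      rw [Finset.sum_range_succ']
      calc ∑ k ∈ Finset.range n, S (k + 1) + S 0
          ≤ ∑ k ∈ Finset.range n, (S k / 2 + e k) + S 0 := by gcongr with k; exact h k
        _ = (∑ k ∈ Finset.range n, S k) / 2 + ∑ k ∈ Finset.range n, e k + S 0 := by
          simp only [Finset.sum_add_distrib, div_eq_mul_inv, Finset.sum_mul]
        _ ≤ 2 * (S 0 + ∑' k, e k) / 2 + ∑' k, e k + S 0 := by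
          gcongr
          exact ENNReal.sum_le_tsum _
        _ = 2 * (S 0 + ∑' k, e k) := by
          rw [mul_comm 2, ENNReal.mul_div_cancel_right (by simp) (by simp)]
          ring
  rw [ENNReal.tsum_eq_iSup_nat]
  exact iSup_le key

/-- The spherical shell `{q ^ (k + 1) * r < ‖x‖ ≤ q ^ k * r}`. -/
def geomShell (E : Type*) [Norm E] (q r : ℝ) (k : ℕ) : Set E :=
  (‖·‖) ⁻¹' Set.Ioc (q ^ (k + 1) * r) (q ^ k * r)

lemma measurableSet_geomShell {E : Type*} [NormedAddCommGroup E] [MeasurableSpace E]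
    [OpensMeasurableSpace E] (q r : ℝ) (k : ℕ) : MeasurableSet (geomShell E q r k) :=
  measurable_norm measurableSet_Ioc

lemma pairwise_disjoint_geomShell {E : Type*} [Norm E] {q r : ℝ} (hq0 : 0 ≤ q)
    (hq1 : q ≤ 1) (hr : 0 ≤ r) : Pairwise (Function.onFun Disjoint (geomShell E q r)) := by
  have hanti : Antitone fun k : ℕ => q ^ k * r := fun m n hmn =>
    mul_le_mul_of_nonneg_right (pow_le_pow_of_le_one hq0 hq1 hmn) hr
  exact fun m n hmn => (hanti.pairwise_disjoint_on_Ioc_succ hmn).preimage _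

lemma mem_iUnion_geomShell {E : Type*} [NormedAddCommGroup E] {q r : ℝ} (hq0 : 0 < q)
    (hq1 : q < 1) (hr : 0 < r) {x : E} (hx0 : x ≠ 0) (hx : ‖x‖ ≤ r) :
    x ∈ ⋃ k, geomShell E q r k := by
  obtain ⟨n, h1, h2⟩ := exists_nat_pow_near_of_lt_one (div_pos (norm_pos_iff.2 hx0) hr)
    ((div_le_one hr).2 hx) hq0 hq1
  exact Set.mem_iUnion.2 ⟨n, (lt_div_iff₀ hr).1 h1, (div_le_iff₀ hr).1 h2⟩

lemma lintegral_geomShell_succ {E : Type*} [NormedAddCommGroup E] [NormedSpace ℝ E]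
    [FiniteDimensional ℝ E] [MeasurableSpace E] [BorelSpace E] (μ : Measure E)
    [μ.IsAddHaarMeasure] {q r : ℝ} (hq : 0 < q) (p : ℝ) (k : ℕ) :
    ∫⁻ x in geomShell E q r (k + 1), ENNReal.ofReal (‖x‖ ^ p) ∂μ =
      ENNReal.ofReal (q ^ ((Module.finrank ℝ E : ℝ) + p)) *
        ∫⁻ x in geomShell E q r k, ENNReal.ofReal (‖x‖ ^ p) ∂μ := by
  set f : E → ENNReal := (geomShell E q r (k + 1)).indicator fun x => ENNReal.ofReal (‖x‖ ^ p)
  have hf : Measurable f :=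
    Measurable.indicator (by fun_prop) (measurableSet_geomShell q r (k + 1))
  have hmap := Measure.map_addHaar_smul μ hq.ne'
  have h1 : ∫⁻ x, f (q • x) ∂μ =
      ENNReal.ofReal (q ^ Module.finrank ℝ E)⁻¹ * ∫⁻ x, f x ∂μ := by
    rw [← lintegral_map hf (measurable_const_smul q), hmap, lintegral_smul_measure,
      abs_of_pos (by positivity), smul_eq_mul]
  have h2 (x : E) : f (q • x) = ENNReal.ofReal (q ^ p) *
      (geomShell E q r k).indicator (fun x => ENNReal.ofReal (‖x‖ ^ p)) x := by
    have hmem : q • x ∈ geomShell E q r (k + 1) ↔ x ∈ geomShell E q r k := by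
      simp only [geomShell, Set.mem_preimage, Set.mem_Ioc, norm_smul, Real.norm_of_nonneg hq.le]
      rw [pow_succ' q (k + 1), mul_assoc, mul_lt_mul_iff_right₀ hq, pow_succ' q k, mul_assoc,
        mul_le_mul_iff_right₀ hq]
    by_cases hx : x ∈ geomShell E q r k
    · simp only [f]
      rw [Set.indicator_of_mem hx, Set.indicator_of_mem (hmem.2 hx), norm_smul,
        Real.norm_of_nonneg hq.le, Real.mul_rpow hq.le (norm_nonneg x),
        ENNReal.ofReal_mul (by positivity)]
    · simp only [f]
      rw [Set.indicator_of_notMem hx, Set.indicator_of_notMem (fun h => hx (hmem.1 h)), mul_zero]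
  simp only [h2] at h1
  rw [lintegral_const_mul' _ _ ENNReal.ofReal_ne_top,
    lintegral_indicator (measurableSet_geomShell q r k),
    lintegral_indicator (measurableSet_geomShell q r (k + 1))] at h1
  rw [Real.rpow_add hq, Real.rpow_natCast, ENNReal.ofReal_mul (by positivity), mul_assoc, h1,
    ← mul_assoc, ← ENNReal.ofReal_mul (by positivity), mul_inv_cancel₀ (by positivity),
    ENNReal.ofReal_one, one_mul]

/-- On `‖x‖, ‖y‖ ≥ ρ` and `‖x - y‖ ≤ R`, the product density `‖x‖ ^ (-2γ) * ‖y‖ ^ (-2γ)` is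
controlled by the singular kernel. -/
lemma sq_sub_mul_weights_le {E : Type*} [NormedAddCommGroup E] {γ σ ρ R D m a : ℝ}
    (hγ : 0 ≤ γ) (hσ : 0 ≤ σ) (hρ : 0 < ρ) (hD : 0 ≤ D) (ha : 0 ≤ a) (ham : a ≤ D * m)
    {w : E → ℝ} {x y : E}
    (hx : ρ ≤ ‖x‖) (hy : ρ ≤ ‖y‖) (hxy : ‖x - y‖ ≤ R) :
    ENNReal.ofReal a * ENNReal.ofReal (‖x‖ ^ (-(2 * γ))) * ENNReal.ofReal (‖y‖ ^ (-(2 * γ))) *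
        ENNReal.ofReal ((w x - w y) ^ 2) ≤
      ENNReal.ofReal (D * ρ ^ (-(2 * γ)) * R ^ σ) * ENNReal.ofReal
        ((w x - w y) ^ 2 * m * (‖x‖ ^ (-γ) * ‖y‖ ^ (-γ) * ‖x - y‖ ^ (-σ))) := by
  have hR : 0 ≤ R := (norm_nonneg _).trans hxy
  rw [← ENNReal.ofReal_mul ha, ← ENNReal.ofReal_mul (by positivity),
    ← ENNReal.ofReal_mul (by positivity), ← ENNReal.ofReal_mul (by positivity)]
  refine ENNReal.ofReal_le_ofReal ?_
  rcases eq_or_ne x y with rfl | hne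
  · simp
  have hd : 0 < ‖x - y‖ := norm_pos_iff.2 (sub_ne_zero.2 hne)
  have hx0 : 0 < ‖x‖ := hρ.trans_le hx
  have hy0 : 0 < ‖y‖ := hρ.trans_le hy
  have hsplit {t : ℝ} (ht : 0 < t) : t ^ (-(2 * γ)) = t ^ (-γ) * t ^ (-γ) := by
    rw [← Real.rpow_add ht]; congr 1; ring
  have h1 : ‖x‖ ^ (-γ) ≤ ρ ^ (-γ) := Real.rpow_le_rpow_of_nonpos hρ hx (by linarith)
  have h2 : ‖y‖ ^ (-γ) ≤ ρ ^ (-γ) := Real.rpow_le_rpow_of_nonpos hρ hy (by linarith)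
  have h3 : 1 ≤ R ^ σ * ‖x - y‖ ^ (-σ) := by
    rw [Real.rpow_neg hd.le, ← div_eq_mul_inv, one_le_div (by positivity)]
    exact Real.rpow_le_rpow hd.le hxy hσ
  rw [hsplit hx0, hsplit hy0, hsplit hρ]
  calc a * (‖x‖ ^ (-γ) * ‖x‖ ^ (-γ)) * (‖y‖ ^ (-γ) * ‖y‖ ^ (-γ)) * (w x - w y) ^ 2
      = a * (‖x‖ ^ (-γ) * ‖y‖ ^ (-γ)) * 1 *
          (‖x‖ ^ (-γ) * ‖y‖ ^ (-γ) * (w x - w y) ^ 2) := by ring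
    _ ≤ (D * m) * (ρ ^ (-γ) * ρ ^ (-γ)) * (R ^ σ * ‖x - y‖ ^ (-σ)) *
          (‖x‖ ^ (-γ) * ‖y‖ ^ (-γ) * (w x - w y) ^ 2) := by
        have : 0 ≤ D * m := ha.trans ham
        gcongr
    _ = _ := by ring

/-- The shell-to-shell comparison, summed over the shells shrinking to the origin. -/
lemma exists_tsum_geomShell_le {E : Type*} [NormedAddCommGroup E] [NormedSpace ℝ E]
    [FiniteDimensional ℝ E] [MeasurableSpace E] [BorelSpace E] (μ : Measure E)
    [μ.IsAddHaarMeasure] {γ σ q r δ : ℝ} (hγ : 0 ≤ γ)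
    (hσ : (Module.finrank ℝ E : ℝ) ≤ σ) (hq0 : 0 < q) (hq1 : q < 1)
    (hq : 4 * q ^ ((Module.finrank ℝ E : ℝ) + -(2 * γ)) ≤ 1) (hr0 : 0 < r) (hr1 : r < 1)
    (hδ : 0 < δ) {ψ : E → ℝ} (hψ : ∀ x, ‖x‖ ≤ r → δ ≤ ψ x)
    (hm0 : ∫⁻ x in geomShell E q r 0, ENNReal.ofReal (‖x‖ ^ (-(2 * γ))) ∂μ ≠ 0)
    (hmt : ∫⁻ x in geomShell E q r 0, ENNReal.ofReal (‖x‖ ^ (-(2 * γ))) ∂μ ≠ ⊤) :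
    ∃ C : ENNReal, C ≠ ⊤ ∧ ∀ w : E → ℝ, Measurable w → ∀ c : ℝ,
      ∑' k, ∫⁻ x in geomShell E q r k,
          ENNReal.ofReal (‖x‖ ^ (-(2 * γ))) * ENNReal.ofReal ((w x - c) ^ 2) ∂μ ≤
        2 * (∫⁻ x in geomShell E q r 0,
          ENNReal.ofReal (‖x‖ ^ (-(2 * γ))) * ENNReal.ofReal ((w x - c) ^ 2) ∂μ) +
        C * ∫⁻ x in Metric.ball 0 1, ∫⁻ y in Metric.ball 0 1,
          ENNReal.ofReal ((w x - w y) ^ 2 * min (ψ x) (ψ y) *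
            (‖x‖ ^ (-γ) * ‖y‖ ^ (-γ) * ‖x - y‖ ^ (-σ))) ∂μ ∂μ := by
  set d : ℝ := (Module.finrank ℝ E : ℝ)
  have hd0 : 0 ≤ d := Nat.cast_nonneg _
  set A := geomShell E q r
  set g : E → ENNReal := fun x => ENNReal.ofReal (‖x‖ ^ (-(2 * γ)))
  have hg : Measurable g := by fun_prop
  set m := ∫⁻ x in A 0, g x ∂μ
  set t : ℝ := q ^ (d + -(2 * γ))
  have ht : 0 < t := by positivity
  have hA (k : ℕ) : MeasurableSet (A k) := measurableSet_geomShell q r k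
  have hmass (k : ℕ) : ∫⁻ x in A k, g x ∂μ = ENNReal.ofReal (t ^ k) * m := by
    induction k with
    | zero => simp [m]
    | succ k ih =>
      rw [lintegral_geomShell_succ μ hq0, ih, pow_succ', ENNReal.ofReal_mul ht.le, mul_assoc]
  set K : ℝ := δ⁻¹ * (q ^ 2) ^ (-(2 * γ)) * 2 ^ σ
  have hK0 : 0 ≤ K := by positivity
  refine ⟨2 * (2 * (ENNReal.ofReal K / m)),
    ENNReal.mul_ne_top (by simp) (ENNReal.mul_ne_top (by simp)
      (ENNReal.div_ne_top (by simp) hm0)), fun w hw c => ?_⟩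
  set F : E → E → ENNReal := fun x y => ENNReal.ofReal ((w x - w y) ^ 2 * min (ψ x) (ψ y) *
            (‖x‖ ^ (-γ) * ‖y‖ ^ (-γ) * ‖x - y‖ ^ (-σ)))
  have hball (k : ℕ) : A k ⊆ Metric.ball 0 1 := fun x hx => by
    have : ‖x‖ ≤ q ^ k * r := hx.2
    have : q ^ k * r ≤ 1 * r := by gcongr; exact pow_le_one₀ hq0.le hq1.le
    rw [mem_ball_zero_iff]
    linarith
  have hstep (k : ℕ) : ∫⁻ x in A (k + 1), g x * ENNReal.ofReal ((w x - c) ^ 2) ∂μ ≤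
      (∫⁻ x in A k, g x * ENNReal.ofReal ((w x - c) ^ 2) ∂μ) / 2 +
        2 * (ENNReal.ofReal K / m) * ∫⁻ x in A (k + 1), ∫⁻ y in A k, F x y ∂μ ∂μ := by
    have hρ : 0 < q ^ (k + 2) * r := by positivity
    have hpair := lintegral_sq_sub_le_of_pair_bound (μ := μ) (hA (k + 1)) (hA k) hg hg hw c
      (F := F)
      (K := ENNReal.ofReal (δ⁻¹ * (q ^ (k + 2) * r) ^ (-(2 * γ)) * (2 * (q ^ k * r)) ^ σ))
      ENNReal.ofReal_ne_top (by
        intro x hx y hy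
        have hx1 : q ^ (k + 2) * r < ‖x‖ := hx.1
        have hx2 : ‖x‖ ≤ q ^ (k + 1) * r := hx.2
        have hy1 : q ^ (k + 1) * r < ‖y‖ := hy.1
        have hy2 : ‖y‖ ≤ q ^ k * r := hy.2
        have e1 : q ^ (k + 2) * r ≤ q ^ (k + 1) * r := by
          gcongr ?_ * r
          exact pow_le_pow_of_le_one hq0.le hq1.le (by omega)
        have e2 : q ^ (k + 1) * r ≤ q ^ k * r := by
          gcongr ?_ * r
          exact pow_le_pow_of_le_one hq0.le hq1.le (by omega)
        have e3 : q ^ k * r ≤ 1 * r := by gcongr; exact pow_le_one₀ hq0.le hq1.le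
        have hmin : δ ≤ min (ψ x) (ψ y) :=
          le_min (hψ x (by linarith)) (hψ y (by linarith))
        have h1 : 1 ≤ δ⁻¹ * min (ψ x) (ψ y) := by
          rw [← inv_mul_cancel₀ hδ.ne']
          gcongr
        have := sq_sub_mul_weights_le (R := 2 * (q ^ k * r)) (w := w) hγ (hd0.trans hσ) hρ
          (inv_nonneg.2 hδ.le)
          zero_le_one h1 hx1.le (by linarith) ((norm_sub_le x y).trans (by linarith))
        rwa [ENNReal.ofReal_one, one_mul] at this)
    rw [hmass, hmass] at hpair
    have htk : 0 < t ^ k := by positivity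
    set M := ENNReal.ofReal (t ^ k) * m
    have hM0 : M ≠ 0 := mul_ne_zero (by simpa using htk) hm0
    have hMt : M ≠ ⊤ := ENNReal.mul_ne_top (by simp) hmt
    have hb1 : 2 * (ENNReal.ofReal (t ^ (k + 1)) * m) ≤ M / 2 := by
      rw [ENNReal.le_div_iff_mul_le (by simp) (by simp)]
      calc 2 * (ENNReal.ofReal (t ^ (k + 1)) * m) * 2
          = ENNReal.ofReal (4 * t * t ^ k) * m := by
            rw [pow_succ', mul_assoc 4, ENNReal.ofReal_mul (by norm_num : (0 : ℝ) ≤ 4),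
              ENNReal.ofReal_ofNat]
            ring
        _ ≤ M := by
          simp only [M]
          gcongr
          exact mul_le_of_le_one_left htk.le hq
    have hb2 : ENNReal.ofReal (δ⁻¹ * (q ^ (k + 2) * r) ^ (-(2 * γ)) * (2 * (q ^ k * r)) ^ σ) ≤
        ENNReal.ofReal K / m * M := by
      have : ENNReal.ofReal K / m * M = ENNReal.ofReal (K * t ^ k) := by
        simp only [M]
        rw [mul_comm (ENNReal.ofReal (t ^ k)), ← mul_assoc, ENNReal.div_mul_cancel hm0 hmt,
          ENNReal.ofReal_mul hK0]
      rw [this]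
      refine ENNReal.ofReal_le_ofReal ?_
      have hQ : 0 < q ^ k * r := by positivity
      have hrw : δ⁻¹ * (q ^ (k + 2) * r) ^ (-(2 * γ)) * (2 * (q ^ k * r)) ^ σ =
          K * ((q ^ k * r) ^ (d + -(2 * γ)) * (q ^ k * r) ^ (σ - d)) := by
        rw [← Real.rpow_add hQ, show q ^ (k + 2) * r = q ^ 2 * (q ^ k * r) by ring,
          Real.mul_rpow (by positivity) hQ.le, Real.mul_rpow (by norm_num) hQ.le,
          show d + -(2 * γ) + (σ - d) = -(2 * γ) + σ by ring, Real.rpow_add hQ]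
        simp only [K]
        ring
      have hpos : 0 ≤ d + -(2 * γ) := by
        by_contra hneg
        have := Real.one_le_rpow_of_pos_of_le_one_of_nonpos hq0 hq1.le (not_le.1 hneg).le
        linarith
      have hle1 : (q ^ k * r) ^ (σ - d) ≤ 1 :=
        Real.rpow_le_one hQ.le (mul_le_one₀ (pow_le_one₀ hq0.le hq1.le) hr0.le hr1.le)
          (by linarith)
      have hle2 : (q ^ k * r) ^ (d + -(2 * γ)) ≤ t ^ k := by
        rw [Real.mul_rpow (by positivity) hr0.le]
        have e : (q ^ k) ^ (d + -(2 * γ)) = t ^ k := by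
          simp only [t]
          rw [← Real.rpow_natCast, ← Real.rpow_natCast, ← Real.rpow_mul hq0.le,
            ← Real.rpow_mul hq0.le, mul_comm]
        rw [e]
        exact mul_le_of_le_one_right htk.le (Real.rpow_le_one hr0.le hr1.le hpos)
      rw [hrw]
      gcongr
      calc _ ≤ t ^ k * 1 := by gcongr
        _ = t ^ k := mul_one _
    rw [← ENNReal.mul_le_mul_iff_right hM0 hMt]
    refine hpair.trans ?_
    rw [← mul_assoc]
    calc _ ≤ M / 2 * (∫⁻ x in A k, g x * ENNReal.ofReal ((w x - c) ^ 2) ∂μ) +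
          2 * (ENNReal.ofReal K / m * M) * ∫⁻ x in A (k + 1), ∫⁻ y in A k, F x y ∂μ ∂μ := by
          gcongr
      _ = _ := by
        simp only [div_eq_mul_inv]
        ring
  refine (ENNReal.tsum_le_of_succ_le_half_add hstep).trans ?_
  rw [mul_add, ENNReal.tsum_mul_left, ← mul_assoc 2 (2 * (ENNReal.ofReal K / m))]
  gcongr
  calc ∑' k, ∫⁻ x in A (k + 1), ∫⁻ y in A k, F x y ∂μ ∂μ
      ≤ ∑' k, ∫⁻ x in A (k + 1), ∫⁻ y in Metric.ball 0 1, F x y ∂μ ∂μ := by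
        gcongr with k x
        exact hball k
    _ = ∫⁻ x in ⋃ k, A (k + 1), ∫⁻ y in Metric.ball 0 1, F x y ∂μ ∂μ :=
        (lintegral_iUnion (fun k => hA (k + 1)) (fun i j hij =>
          pairwise_disjoint_geomShell hq0.le hq1.le hr0.le (by simpa using hij)) _).symm
    _ ≤ _ := lintegral_mono_set (Set.iUnion_subset fun k => hball (k + 1))

/-- A common lower bound for the weighted variances about all centres is controlled by the
energy. -/
lemma exists_le_mul_energy {E : Type*} [NormedAddCommGroup E] [NormedSpace ℝ E]
    [FiniteDimensional ℝ E] [Nontrivial E] [MeasurableSpace E] [BorelSpace E] (μ : Measure E)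
    [μ.IsAddHaarMeasure] {γ σ r δ : ℝ} (hγ : 0 ≤ γ) (hγd : 2 * γ < Module.finrank ℝ E)
    (hσ : (Module.finrank ℝ E : ℝ) ≤ σ) (hr0 : 0 < r) (hr1 : r < 1)
    (hδ : 0 < δ) {ψ : E → ℝ} (hψm : Measurable ψ) (hψ : ∀ x, ‖x‖ ≤ r → δ ≤ ψ x)
    (hψ0 : ∀ x, 0 ≤ ψ x) (hψ1 : ∀ x, ψ x ≤ 1) :
    ∃ C : ENNReal, C ≠ ⊤ ∧ ∀ w : E → ℝ, Measurable w → ∀ L : ENNReal,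
      (∀ c : ℝ, L ≤ ∫⁻ x in Metric.ball 0 1, ENNReal.ofReal (ψ x) *
        ENNReal.ofReal (‖x‖ ^ (-(2 * γ))) * ENNReal.ofReal ((w x - c) ^ 2) ∂μ) →
      L ≤ C * ∫⁻ x in Metric.ball 0 1, ∫⁻ y in Metric.ball 0 1,
          ENNReal.ofReal ((w x - w y) ^ 2 * min (ψ x) (ψ y) *
            (‖x‖ ^ (-γ) * ‖y‖ ^ (-γ) * ‖x - y‖ ^ (-σ))) ∂μ ∂μ := by
  set d : ℝ := (Module.finrank ℝ E : ℝ)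
  have hσ0 : 0 ≤ σ := (Nat.cast_nonneg _).trans hσ
  obtain ⟨q, hq0, hq1, hq⟩ : ∃ q : ℝ, 0 < q ∧ q < 1 ∧ 4 * q ^ (d + -(2 * γ)) ≤ 1 := by
    have hp : 0 < d + -(2 * γ) := by linarith
    refine ⟨(1 / 4) ^ (1 / (d + -(2 * γ))), by positivity,
      Real.rpow_lt_one (by norm_num) (by norm_num) (by positivity), ?_⟩
    rw [← Real.rpow_mul (by norm_num), one_div_mul_cancel hp.ne', Real.rpow_one]
    norm_num
  set A := geomShell E q r
  have hA (k : ℕ) : MeasurableSet (A k) := measurableSet_geomShell q r k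
  set g : E → ENNReal := fun x => ENNReal.ofReal (‖x‖ ^ (-(2 * γ)))
  have hg : Measurable g := by fun_prop
  have hψg : Measurable fun x => ENNReal.ofReal (ψ x) * g x := by fun_prop
  have hqr : 0 < q * r := by positivity
  have hqr1 : q * r < r := mul_lt_of_lt_one_left hr0 hq1
  have hA0 : A 0 ⊆ Metric.ball 0 1 := fun x hx => by
    have : ‖x‖ ≤ q ^ 0 * r := hx.2
    rw [pow_zero, one_mul] at this
    exact mem_ball_zero_iff.2 (by linarith)
  set O : Set E := {x | q * r < ‖x‖} ∩ Metric.ball 0 1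
  have hO : MeasurableSet O :=
    (measurableSet_lt measurable_const measurable_norm).inter measurableSet_ball
  have hA0O : A 0 ⊆ O := fun x hx => ⟨by simpa using hx.1, hA0 hx⟩
  have hgO : ∫⁻ x in O, g x ∂μ ≠ ⊤ := by
    refine ne_top_of_le_ne_top (b := ∫⁻ x in O, ENNReal.ofReal ((q * r) ^ (-(2 * γ))) ∂μ) ?_ ?_
    · rw [setLIntegral_const]
      exact ENNReal.mul_ne_top (by simp)
        ((measure_mono Set.inter_subset_right).trans_lt measure_ball_lt_top).ne
    · exact setLIntegral_mono' hO fun x hx => ENNReal.ofReal_le_ofReal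
        (Real.rpow_le_rpow_of_nonpos hqr (le_of_lt hx.1) (by linarith))
  set m := ∫⁻ x in A 0, g x ∂μ
  have hmt : m ≠ ⊤ := ne_top_of_le_ne_top hgO (lintegral_mono_set hA0O)
  have hm0 : m ≠ 0 := by
    have hopen : IsOpen ((‖·‖) ⁻¹' Set.Ioo (q * r) r : Set E) :=
      isOpen_Ioo.preimage continuous_norm
    obtain ⟨z, hz⟩ := exists_norm_eq E (show 0 ≤ (q * r + r) / 2 by positivity)
    have hpos : 0 < μ ((‖·‖) ⁻¹' Set.Ioo (q * r) r : Set E) :=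
      hopen.measure_pos μ ⟨z, by simp only [Set.mem_preimage, hz]; constructor <;> linarith⟩
    have hsub : ((‖·‖) ⁻¹' Set.Ioo (q * r) r : Set E) ⊆ A 0 := fun x hx =>
      ⟨by simpa using hx.1, by simpa using (hx.2 : ‖x‖ < r).le⟩
    have : μ (A 0) ≤ m := by
      rw [← setLIntegral_one]
      refine setLIntegral_mono' (hA 0) fun x hx => ?_
      have hx1 : ‖x‖ < 1 := mem_ball_zero_iff.1 (hA0 hx)
      have hx0 : 0 < ‖x‖ := hqr.trans (hA0O hx).1
      simpa [g] using Real.one_le_rpow_of_pos_of_le_one_of_nonpos hx0 hx1.le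
        (show -(2 * γ) ≤ 0 by linarith)
    exact ((hpos.trans_le (measure_mono hsub)).trans_le this).ne'
  obtain ⟨C₁, hC₁, hinner⟩ := exists_tsum_geomShell_le μ hγ hσ hq0 hq1 hq hr0 hr1 hδ hψ hm0 hmt
  set α := ∫⁻ x in O, ENNReal.ofReal (ψ x) * g x ∂μ
  have hα : α ≠ ⊤ := ne_top_of_le_ne_top hgO (lintegral_mono fun x =>
    mul_le_of_le_one_left' (ENNReal.ofReal_le_one.2 (hψ1 x)))
  set K : ENNReal := ENNReal.ofReal (δ⁻¹ * (q * r) ^ (-(2 * γ)) * 2 ^ σ)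
  have hK : K ≠ ⊤ := ENNReal.ofReal_ne_top
  have hcst : (2 * α + 2 * m) * K + m * (2 * K + m * C₁) ≠ ⊤ := by finiteness
  refine ⟨((2 * α + 2 * m) * K + m * (2 * K + m * C₁)) / (m * m),
    ENNReal.div_ne_top hcst (mul_ne_zero hm0 hm0), fun w hw L hL => ?_⟩
  set F : E → E → ENNReal := fun x y => ENNReal.ofReal ((w x - w y) ^ 2 * min (ψ x) (ψ y) *
            (‖x‖ ^ (-γ) * ‖y‖ ^ (-γ) * ‖x - y‖ ^ (-σ)))
  set I := ∫⁻ x in Metric.ball 0 1, ∫⁻ y in Metric.ball 0 1, F x y ∂μ ∂μ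
  have hsub {s t : Set E} (hs : s ⊆ Metric.ball 0 1) (ht : t ⊆ Metric.ball 0 1) :
      ∫⁻ x in s, ∫⁻ y in t, F x y ∂μ ∂μ ≤ I :=
    (lintegral_mono fun x => lintegral_mono_set ht).trans (lintegral_mono_set hs)
  have hnorm {x y : E} (hx : x ∈ O) (hy : y ∈ A 0) : ‖x - y‖ ≤ 2 := by
    have h1 : ‖x‖ < 1 := mem_ball_zero_iff.1 hx.2
    have h2 : ‖y‖ < 1 := mem_ball_zero_iff.1 (hA0 hy)
    linarith [norm_sub_le x y]
  have hψA {y : E} (hy : y ∈ A 0) : δ ≤ ψ y := hψ y (by simpa using hy.2)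
  have hδ1 {x y : E} (hy : y ∈ A 0) : ψ x ≤ δ⁻¹ * min (ψ x) (ψ y) := by
    have := hψA hy
    rw [inv_mul_eq_div, le_div_iff₀ hδ]
    exact le_min (mul_le_of_le_one_right (hψ0 x) (this.trans (hψ1 y)))
      ((mul_le_of_le_one_left hδ.le (hψ1 x)).trans this)
  set S : ℝ → ENNReal := fun c => ∫⁻ x in A 0, g x * ENNReal.ofReal ((w x - c) ^ 2) ∂μ
  have houter (c : ℝ) : m * ∫⁻ x in O, ENNReal.ofReal (ψ x) * g x *
      ENNReal.ofReal ((w x - c) ^ 2) ∂μ ≤ 2 * (α * S c) + 2 * K * I := by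
    refine (lintegral_sq_sub_le_of_pair_bound hO (hA 0) hψg hg hw c (F := F) hK
      fun x hx y hy => ?_).trans ?_
    · exact sq_sub_mul_weights_le hγ hσ0 hqr (inv_nonneg.2 hδ.le) (hψ0 x) (hδ1 hy) (le_of_lt hx.1)
        (le_of_lt (hA0O hy).1) (hnorm hx hy)
    · gcongr
      exact hsub Set.inter_subset_right hA0
  have hmean : ∫⁻ y in A 0, g y * S (w y) ∂μ ≤ K * I := by
    refine (lintegral_lintegral_sq_sub_le (hA 0) (hA 0) hg hw (F := F) hK
      fun x hx y hy => ?_).trans ?_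
    · have h1 : 1 ≤ δ⁻¹ * min (ψ x) (ψ y) := by
        rw [← inv_mul_cancel₀ hδ.ne']
        gcongr
        exact le_min (hψA hx) (hψA hy)
      have := sq_sub_mul_weights_le (w := w) hγ hσ0 hqr (inv_nonneg.2 hδ.le) zero_le_one h1
        (le_of_lt (hA0O hx).1) (le_of_lt (hA0O hy).1) (hnorm (hA0O hx) hy)
      rwa [ENNReal.ofReal_one, one_mul, mul_comm (ENNReal.ofReal (‖x‖ ^ (-(2 * γ))))] at this
    · gcongr
      exact hsub hA0 hA0
  have hcover : Metric.ball (0 : E) 1 ⊆ O ∪ ((⋃ k, A k) ∪ {0}) := fun x hx => by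
    by_cases h1 : q * r < ‖x‖
    · exact Or.inl ⟨h1, hx⟩
    · by_cases h0 : x = 0
      · exact Or.inr (Or.inr h0)
      · exact Or.inr (Or.inl (mem_iUnion_geomShell hq0 hq1 hr0 h0 (by linarith)))
  have hall (c : ℝ) : m * L ≤ (2 * α + 2 * m) * S c + (2 * K + m * C₁) * I := by
    set f : E → ENNReal := fun x => ENNReal.ofReal (ψ x) * g x * ENNReal.ofReal ((w x - c) ^ 2)
    have h0 : ∫⁻ x in ({0} : Set E), f x ∂μ = 0 :=
      setLIntegral_measure_zero _ _ (measure_singleton 0)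
    calc m * L ≤ m * ∫⁻ x in Metric.ball 0 1, f x ∂μ := by gcongr; exact hL c
      _ ≤ m * (∫⁻ x in O, f x ∂μ + (∑' k, ∫⁻ x in A k, f x ∂μ + 0)) := by
        gcongr
        refine (lintegral_mono_set hcover).trans ((lintegral_union_le _ _ _).trans ?_)
        gcongr
        refine (lintegral_union_le _ _ _).trans ?_
        rw [h0]
        gcongr
        exact lintegral_iUnion_le _ _
      _ ≤ m * ∫⁻ x in O, f x ∂μ + m * (2 * S c + C₁ * I) := by
        rw [add_zero, mul_add]
        gcongr
        refine le_trans ?_ (hinner w hw c)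
        gcongr with k x
        exact (mul_assoc _ _ _).trans_le (mul_le_of_le_one_left' (ENNReal.ofReal_le_one.2 (hψ1 x)))
      _ ≤ 2 * (α * S c) + 2 * K * I + m * (2 * S c + C₁ * I) := by
        gcongr
        exact houter c
      _ = _ := by ring
  have hfin : m * m * L ≤ ((2 * α + 2 * m) * K + m * (2 * K + m * C₁)) * I := by
    calc m * m * L = ∫⁻ y in A 0, g y * (m * L) ∂μ := by
          rw [lintegral_mul_const _ hg, mul_assoc]
      _ ≤ ∫⁻ y in A 0, ((2 * α + 2 * m) * (g y * S (w y)) +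
            g y * ((2 * K + m * C₁) * I)) ∂μ := by
          refine lintegral_mono fun y => ?_
          refine (mul_le_mul_right (hall (w y)) (g y)).trans_eq ?_
          ring
      _ = (2 * α + 2 * m) * ∫⁻ y in A 0, g y * S (w y) ∂μ + m * ((2 * K + m * C₁) * I) := by
          rw [lintegral_add_right _ (hg.mul_const _), lintegral_mul_const _ hg,
            lintegral_const_mul' _ _ (by finiteness)]
      _ ≤ (2 * α + 2 * m) * (K * I) + m * ((2 * K + m * C₁) * I) := by gcongr
      _ = _ := by ring
  rw [← ENNReal.mul_div_right_comm, ENNReal.le_div_iff_mul_le (Or.inl (mul_ne_zero hm0 hm0))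
    (Or.inl (ENNReal.mul_ne_top hmt hmt)), mul_comm]
  exact hfin

/-- The weighted mean minimises the weighted quadratic deviation. -/
lemma integral_sq_sub_mean_le {X : Type*} [MeasurableSpace X] {μ : Measure X} {w ρ : X → ℝ}
    (hρ0 : ∀ x, 0 ≤ ρ x) (hρ : Integrable ρ μ) (hwρ : Integrable (fun x => w x * ρ x) μ)
    (hw2ρ : Integrable (fun x => w x ^ 2 * ρ x) μ) (c : ℝ) :
    ∫ x, (w x - (∫ y, w y * ρ y ∂μ) / ∫ y, ρ y ∂μ) ^ 2 * ρ x ∂μ ≤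
      ∫ x, (w x - c) ^ 2 * ρ x ∂μ := by
  have hexp (b : ℝ) : ∫ x, (w x - b) ^ 2 * ρ x ∂μ =
      ∫ x, w x ^ 2 * ρ x ∂μ - 2 * b * ∫ x, w x * ρ x ∂μ + b ^ 2 * ∫ x, ρ x ∂μ := by
    rw [← integral_const_mul, ← integral_const_mul, ← integral_sub hw2ρ (hwρ.const_mul _),
      ← integral_add (f := fun x => w x ^ 2 * ρ x - 2 * b * (w x * ρ x))
        (hw2ρ.sub (hwρ.const_mul _)) (hρ.const_mul _)]
    congr 1 with x
    ring
  rw [hexp, hexp]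
  set Z := ∫ x, ρ x ∂μ with hZ
  have hZ0 : 0 ≤ Z := integral_nonneg hρ0
  rcases hZ0.eq_or_lt with h0 | hpos
  · have hae : ρ =ᵐ[μ] 0 := (integral_eq_zero_iff_of_nonneg hρ0 hρ).1 (by rw [← hZ, ← h0])
    have h1 : ∫ x, w x * ρ x ∂μ = 0 :=
      integral_eq_zero_of_ae (hae.mono fun x hx => by simp [hx])
    simp [h1, ← h0]
  · set M := ∫ x, w x * ρ x ∂μ
    have hM : M = M / Z * Z := by field_simp
    generalize M / Z = a at hM ⊢
    rw [hM]
    nlinarith [mul_nonneg hZ0 (sq_nonneg (a - c))]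

/-- **Weighted Poincaré–Wirtinger inequality**: let `ψ(x) = h(|x|)` be a radial nonincreasing
cutoff supported in `B_1` with `0 ≤ ψ ≤ 1`, `ψ ≢ 0`. Then there is `C = C(N,s,γ,ψ) > 0` such
that every `w ∈ Y^{s,γ}(B_1)` satisfies
`∫_{B_1} (w - W_ψ)² ψ dμ ≤ C ∫_{B_1}∫_{B_1} (w(x)-w(y))² min{ψ(x),ψ(y)} dν`,
where `W_ψ = (∫_{B_1} w ψ dμ)/(∫_{B_1} ψ dμ)`. -/
theorem weighted_poincare_wirtinger (N : ℕ) (s γ : ℝ) (hs0 : 0 < s) (hs1 : s < 1)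
    (hN : 2 * s < (N : ℝ)) (hγ0 : 0 < γ) (hγ : γ < ((N : ℝ) - 2 * s) / 2)
    (ψ : EuclideanSpace ℝ (Fin N) → ℝ) (h : ℝ → ℝ)
    (hrad : ∀ x, ψ x = h ‖x‖) (hmono : AntitoneOn h (Set.Ici 0))
    (hsupp : Function.support ψ ⊆ Metric.ball (0 : EuclideanSpace ℝ (Fin N)) 1)
    (hψ0 : ∀ x, 0 ≤ ψ x) (hψ1 : ∀ x, ψ x ≤ 1) (hψne : ψ ≠ 0) :
    ∃ C : ℝ, 0 < C ∧ ∀ w : EuclideanSpace ℝ (Fin N) → ℝ, Measurable w →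
      YnormFinite N s γ (Metric.ball (0 : EuclideanSpace ℝ (Fin N)) 1) w →
      (∫ x in Metric.ball (0 : EuclideanSpace ℝ (Fin N)) 1,
          (w x -
              (∫ y in Metric.ball (0 : EuclideanSpace ℝ (Fin N)) 1,
                  w y * ψ y * ‖y‖ ^ (-(2 * γ))) /
                (∫ y in Metric.ball (0 : EuclideanSpace ℝ (Fin N)) 1,
                  ψ y * ‖y‖ ^ (-(2 * γ)))) ^ 2 *
            ψ x * ‖x‖ ^ (-(2 * γ))) ≤
        C * ∫ x in Metric.ball (0 : EuclideanSpace ℝ (Fin N)) 1,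
              ∫ y in Metric.ball (0 : EuclideanSpace ℝ (Fin N)) 1,
                (w x - w y) ^ 2 * min (ψ x) (ψ y) *
                  (‖x‖ ^ (-γ) * ‖y‖ ^ (-γ) * ‖x - y‖ ^ (-((N : ℝ) + 2 * s))) := by
  have hNpos : 0 < N := by
    have : (0 : ℝ) < N := by linarith
    exact_mod_cast this
  have : Nonempty (Fin N) := ⟨⟨0, hNpos⟩⟩
  set B := Metric.ball (0 : EuclideanSpace ℝ (Fin N)) 1
  have hRnn (w : EuclideanSpace ℝ (Fin N) → ℝ) (x y : EuclideanSpace ℝ (Fin N)) :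
      0 ≤ (w x - w y) ^ 2 * min (ψ x) (ψ y) *
        (‖x‖ ^ (-γ) * ‖y‖ ^ (-γ) * ‖x - y‖ ^ (-((N : ℝ) + 2 * s))) :=
    mul_nonneg (mul_nonneg (sq_nonneg _) (le_min (hψ0 x) (hψ0 y))) (by positivity)
  have hψm : Measurable ψ := by
    have hanti : Antitone fun t : ℝ => h (max t 0) := fun a b hab =>
      hmono (Set.mem_Ici.2 (le_max_right _ _)) (Set.mem_Ici.2 (le_max_right _ _)) (max_le_max_right 0 hab)
    have : ψ = fun x => (fun t : ℝ => h (max t 0)) ‖x‖ := by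
      ext x
      simp [hrad]
    rw [this]
    exact hanti.measurable.comp measurable_norm
  by_cases hex : ∃ r, 0 < r ∧ 0 < h r
  swap
  · refine ⟨1, one_pos, fun w _ _ => ?_⟩
    have hψz : ∀ᵐ x ∂(volume.restrict B), ψ x = 0 := by
      refine ae_restrict_of_ae ((Measure.ae_ne volume 0).mono fun x hx => ?_)
      by_contra hne
      exact hex ⟨‖x‖, norm_pos_iff.2 hx, hrad x ▸ lt_of_le_of_ne (hψ0 x) (Ne.symm hne)⟩
    rw [integral_eq_zero_of_ae (hψz.mono fun x hx => by simp [hx]), one_mul]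
    exact integral_nonneg fun x => integral_nonneg fun y => hRnn w x y
  obtain ⟨r, hr0, hδ⟩ := hex
  have hr1 : r < 1 := by
    obtain ⟨z, hz⟩ := exists_norm_eq (EuclideanSpace ℝ (Fin N)) hr0.le
    have : z ∈ Function.support ψ := by
      rw [Function.mem_support, hrad, hz]
      exact hδ.ne'
    exact hz ▸ mem_ball_zero_iff.1 (hsupp this)
  have hψr (x : EuclideanSpace ℝ (Fin N)) (hx : ‖x‖ ≤ r) : h r ≤ ψ x :=
    hrad x ▸ hmono (norm_nonneg x) hr0.le hx
  have hfr : (Module.finrank ℝ (EuclideanSpace ℝ (Fin N)) : ℝ) = N := by simp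
  obtain ⟨C, hC, hmain⟩ := exists_le_mul_energy
    (volume : Measure (EuclideanSpace ℝ (Fin N))) (γ := γ) (σ := (N : ℝ) + 2 * s) hγ0.le
    (by rw [hfr]; linarith) (by rw [hfr]; linarith) hr0 hr1 hδ hψm hψr hψ0 hψ1
  refine ⟨C.toReal + 1, by positivity, fun w hw ⟨hw1, hw2⟩ => ?_⟩
  set ρ : EuclideanSpace ℝ (Fin N) → ℝ := fun x => ψ x * ‖x‖ ^ (-(2 * γ))
  have hρm : Measurable ρ := by fun_prop
  have hρ0 (x : EuclideanSpace ℝ (Fin N)) : 0 ≤ ρ x := mul_nonneg (hψ0 x) (by positivity)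
  have hρle (x : EuclideanSpace ℝ (Fin N)) : ρ x ≤ ‖x‖ ^ (-(2 * γ)) :=
    mul_le_of_le_one_left (by positivity) (hψ1 x)
  have hρi : Integrable ρ (volume.restrict B) := by
    refine integrableOn_ball_of_norm_le_rpow (C := 1) (α := 2 * γ) (by simpa using Nat.succ_le_iff.2 hNpos)
      (by rw [hfr]; linarith) (ae_of_all _ fun x => ?_) hρm.aestronglyMeasurable
    rw [one_mul, Real.norm_of_nonneg (hρ0 x)]
    exact hρle x
  have hw2ρ : Integrable (fun x => w x ^ 2 * ρ x) (volume.restrict B) := by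
    refine hw1.mono' (by fun_prop) (ae_of_all _ fun x => ?_)
    rw [Real.norm_of_nonneg (mul_nonneg (sq_nonneg _) (hρ0 x))]
    exact mul_le_mul_of_nonneg_left (hρle x) (sq_nonneg _)
  have hwρ : Integrable (fun x => w x * ρ x) (volume.restrict B) := by
    refine (hρi.add hw2ρ).mono' (by fun_prop) (ae_of_all _ fun x => ?_)
    rw [norm_mul, Real.norm_of_nonneg (hρ0 x), Real.norm_eq_abs, Pi.add_apply]
    have : |w x| ≤ 1 + w x ^ 2 := by nlinarith [sq_abs (w x), sq_nonneg (|w x| - 1)]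
    nlinarith [mul_le_mul_of_nonneg_right this (hρ0 x)]
  have hdev (c : ℝ) : Integrable (fun x => (w x - c) ^ 2 * ρ x) (volume.restrict B) := by
    refine ((hw2ρ.sub (hwρ.const_mul (2 * c))).add (hρi.const_mul (c ^ 2))).congr
      (ae_of_all _ fun x => ?_)
    simp only [Pi.add_apply, Pi.sub_apply]
    ring
  set F : EuclideanSpace ℝ (Fin N) × EuclideanSpace ℝ (Fin N) → ℝ := fun p =>
    (w p.1 - w p.2) ^ 2 * min (ψ p.1) (ψ p.2) *
      (‖p.1‖ ^ (-γ) * ‖p.2‖ ^ (-γ) * ‖p.1 - p.2‖ ^ (-((N : ℝ) + 2 * s)))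
  have hFm : Measurable F := by fun_prop
  have hF0 (p : EuclideanSpace ℝ (Fin N) × EuclideanSpace ℝ (Fin N)) : 0 ≤ F p := hRnn w p.1 p.2
  have hFi : Integrable F ((volume.restrict B).prod (volume.restrict B)) := by
    refine hw2.mono' hFm.aestronglyMeasurable (ae_of_all _ fun p => ?_)
    rw [Real.norm_of_nonneg (hF0 p)]
    exact mul_le_mul_of_nonneg_right
      (mul_le_of_le_one_right (sq_nonneg _) ((min_le_left _ _).trans (hψ1 _))) (by positivity)
  have hR : ∫⁻ x in B, ∫⁻ y in B, ENNReal.ofReal (F (x, y)) =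
      ENNReal.ofReal (∫ x in B, ∫ y in B, F (x, y)) := by
    rw [← integral_prod _ hFi, ofReal_integral_eq_lintegral_ofReal hFi (ae_of_all _ hF0),
      lintegral_prod _ (by fun_prop)]
  have hmean := integral_sq_sub_mean_le hρ0 hρi hwρ hw2ρ
  have hL := hmain w hw (ENNReal.ofReal
      (∫ x in B, (w x - (∫ y in B, w y * ρ y) / ∫ y in B, ρ y) ^ 2 * ρ x)) fun c => by
    refine (ENNReal.ofReal_le_ofReal (hmean c)).trans_eq ?_
    rw [ofReal_integral_eq_lintegral_ofReal (hdev c)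
      (ae_of_all _ fun x => mul_nonneg (sq_nonneg _) (hρ0 x))]
    refine lintegral_congr fun x => ?_
    rw [← ENNReal.ofReal_mul (hψ0 x), ← ENNReal.ofReal_mul (hρ0 x), mul_comm]
  have hI0 : 0 ≤ ∫ x in B, ∫ y in B, F (x, y) :=
    integral_nonneg fun x => integral_nonneg fun y => hF0 (x, y)
  replace hL := hL.trans_eq (congrArg (C * ·) hR)
  rw [← ENNReal.ofReal_toReal hC, ← ENNReal.ofReal_mul ENNReal.toReal_nonneg,
    ENNReal.ofReal_le_ofReal_iff (by positivity)] at hL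
  simp only [ρ, ← mul_assoc] at hL
  refine hL.trans (mul_le_mul_of_nonneg_right ?_ hI0)
  linarith

end
end
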